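/- arXiv:1109.4591 — 3 statements merged into one kernel-verified Lean document; each statement's English description precedes it below -/
import Mathlib

section
/- Let M : ... → M^{-1} → M^0 → M^1 → ... be a bounded complex of coherent sheaves on P^n with homology sheaves F^t = H^t(M). Fix an integer j. If H^{j-t}(M^t) = 0 for all t, H^{j-t-1}(F^t) = 0 for all t > 0, and H^{j-t+1}(F^t) = 0 for all t < 0, then H^j(F^0) = 0. -/
open CategoryTheory Limits

universe v u v' u'

namespace CategoryTheory

open Category Pretriangulated ComplexShape

section Extend

variable {C : Type u} [Category.{v} C] [Preadditive C] [HasZeroObject C]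
  {D : Type u'} [Category.{v'} D] [Preadditive D] [HasZeroObject D] (F : C ⥤ D) [F.Additive]

/-- An additive functor commutes, degree by degree, with the extension by zero. -/
noncomputable def Functor.mapExtendXIso {ι : Type*} {c : ComplexShape ι}
    (K : HomologicalComplex C c) : ∀ i : Option ι,
    F.obj (HomologicalComplex.extend.X K i) ≅
      HomologicalComplex.extend.X ((F.mapHomologicalComplex c).obj K) i
  | some _ => Iso.refl _
  | none => (F.map_isZero (HomologicalComplex.extend.isZero_X K rfl)).iso
      (HomologicalComplex.extend.isZero_X _ rfl)

lemma Functor.mapExtendXIso_hom_comm {ι : Type*} {c : ComplexShape ι}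
    (K : HomologicalComplex C c) (i j : Option ι) :
    (F.mapExtendXIso K i).hom ≫
        HomologicalComplex.extend.d ((F.mapHomologicalComplex c).obj K) i j =
      F.map (HomologicalComplex.extend.d K i j) ≫ (F.mapExtendXIso K j).hom := by
  match i, j with
  | none, _ => exact (F.map_isZero (HomologicalComplex.extend.isZero_X K rfl)).eq_of_src _ _
  | some _, none => exact (HomologicalComplex.extend.isZero_X _ rfl).eq_of_tgt _ _
  | some _, some _ => exact (id_comp _).trans (comp_id _).symm

/-- An additive functor commutes with the extension by zero of homological complexes. -/
noncomputable def Functor.mapHomologicalComplexExtendIso {ι ι' : Type*} {c : ComplexShape ι}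
    {c' : ComplexShape ι'} (e : c.Embedding c') (K : HomologicalComplex C c) :
    (F.mapHomologicalComplex c').obj (K.extend e) ≅
      ((F.mapHomologicalComplex c).obj K).extend e :=
  HomologicalComplex.Hom.isoOfComponents (fun i ↦ F.mapExtendXIso K (e.r i))
    (fun i j _ ↦ F.mapExtendXIso_hom_comm K (e.r i) (e.r j))

end Extend

section KInjective

variable {C : Type u} [Category.{v} C] [Abelian C]

/-- Between right orthogonals of the acyclic complexes, isomorphisms lift from the derived
category to the homotopy category. -/
lemma HomotopyCategory.nonempty_iso_of_rightOrthogonal [HasDerivedCategory C]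
    {K L : HomotopyCategory C (.up ℤ)}
    (hK : (HomotopyCategory.subcategoryAcyclic C).rightOrthogonal K)
    (hL : (HomotopyCategory.subcategoryAcyclic C).rightOrthogonal L)
    (e : DerivedCategory.Qh.obj K ≅ DerivedCategory.Qh.obj L) : Nonempty (K ≅ L) := by
  obtain ⟨f, hf⟩ := (hL.map_bijective_of_isTriangulated DerivedCategory.Qh K).surjective e.hom
  obtain ⟨g, hg⟩ := (hK.map_bijective_of_isTriangulated DerivedCategory.Qh L).surjective e.inv
  exact ⟨f, g,
    (hK.map_bijective_of_isTriangulated DerivedCategory.Qh K).injective (by simp [hf, hg]),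
    (hL.map_bijective_of_isTriangulated DerivedCategory.Qh L).injective (by simp [hf, hg])⟩

/-- The image of an injective resolution in the derived category. -/
noncomputable def InjectiveResolution.qhIso [HasDerivedCategory C] {X : C}
    (I : InjectiveResolution X) :
    DerivedCategory.Qh.obj ((HomotopyCategory.quotient C (.up ℤ)).obj I.cochainComplex) ≅
      (DerivedCategory.singleFunctor C 0).obj X :=
  (DerivedCategory.quotientCompQhIso C).app _ ≪≫ (asIso (DerivedCategory.Q.map I.ι')).symm ≪≫
    ((SingleFunctors.evaluation _ _ 0).mapIso
      (DerivedCategory.singleFunctorsPostcompQIso C)).symm.app X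

/-- A short exact sequence induces a distinguished triangle between injective resolutions. -/
lemma ShortComplex.ShortExact.exists_distTriang_injectiveResolution {S : ShortComplex C}
    (hS : S.ShortExact) (I₁ : InjectiveResolution S.X₁) (I₂ : InjectiveResolution S.X₂)
    (I₃ : InjectiveResolution S.X₃) :
    ∃ (T : Triangle (HomotopyCategory C (.up ℤ))) (_ : T ∈ distTriang _),
      Nonempty (T.obj₁ ≅ (HomotopyCategory.quotient _ _).obj I₁.cochainComplex) ∧
      Nonempty (T.obj₂ ≅ (HomotopyCategory.quotient _ _).obj I₂.cochainComplex) ∧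
      Nonempty (T.obj₃ ≅ (HomotopyCategory.quotient _ _).obj I₃.cochainComplex) := by
  let := HasDerivedCategory.standard C
  have h₁ := CochainComplex.IsKInjective.rightOrthogonal I₁.cochainComplex
  have h₂ := CochainComplex.IsKInjective.rightOrthogonal I₂.cochainComplex
  have h₃ := CochainComplex.IsKInjective.rightOrthogonal I₃.cochainComplex
  obtain ⟨f, hf⟩ := (h₂.map_bijective_of_isTriangulated DerivedCategory.Qh
    ((HomotopyCategory.quotient _ _).obj I₁.cochainComplex)).surjective
    (I₁.qhIso.hom ≫ (DerivedCategory.singleFunctor C 0).map S.f ≫ I₂.qhIso.inv)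
  obtain ⟨Z, g, h, hT⟩ := distinguished_cocone_triangle f
  refine ⟨_, hT, ⟨Iso.refl _⟩, ⟨Iso.refl _⟩, HomotopyCategory.nonempty_iso_of_rightOrthogonal
    (ObjectProperty.ext_of_isTriangulatedClosed₃ _ _ hT h₁ h₂) h₃ ?_⟩
  have comm : DerivedCategory.Qh.map f ≫ I₂.qhIso.hom =
      I₁.qhIso.hom ≫ (DerivedCategory.singleFunctor C 0).map S.f := by
    simp [hf]
  exact Triangle.π₃.mapIso (isoTriangleOfIso₁₂ _ _
    (DerivedCategory.Qh.map_distinguished _ hT) hS.singleTriangle_distinguished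
    I₁.qhIso I₂.qhIso comm) ≪≫ I₃.qhIso.symm

end KInjective

section RightDerived

variable {C : Type u} [Category.{v} C] [Abelian C] [EnoughInjectives C]
  {D : Type u'} [Category.{v'} D] [Abelian D] (F : C ⥤ D) [F.Additive]

/-- The vanishing at `X` of the right derived functor of `F` in an integer degree; this holds
automatically in negative degrees. -/
def Functor.RightDerivedVanishes (i : ℤ) (X : C) : Prop :=
  ∀ q : ℕ, (q : ℤ) = i → IsZero ((F.rightDerived q).obj X)

/-- The cohomology in integer degrees of the image by an additive functor of
a complex up to homotopy. -/
noncomputable abbrev Functor.mapHomotopyCategoryHomology (i : ℤ) :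
    HomotopyCategory C (.up ℤ) ⥤ D :=
  F.mapHomotopyCategory (.up ℤ) ⋙ HomotopyCategory.homologyFunctor D (.up ℤ) i

lemma Functor.rightDerivedVanishes_iff {i : ℤ} {X : C} (I : InjectiveResolution X) :
    F.RightDerivedVanishes i X ↔ IsZero ((F.mapHomotopyCategoryHomology i).obj
      ((HomotopyCategory.quotient _ _).obj I.cochainComplex)) := by
  let K := ((F.mapHomologicalComplex (.up ℕ)).obj I.cocomplex)
  have e : (F.mapHomotopyCategoryHomology i).obj
      ((HomotopyCategory.quotient _ _).obj I.cochainComplex) ≅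
      (K.extend embeddingUpNat).homology i :=
    (HomotopyCategory.homologyFunctorFactors D (.up ℤ) i).app
      ((F.mapHomologicalComplex (.up ℤ)).obj I.cochainComplex) ≪≫
    (HomologicalComplex.homologyFunctor D (.up ℤ) i).mapIso
      (F.mapHomologicalComplexExtendIso embeddingUpNat I.cocomplex)
  rw [e.isZero_iff]
  refine ⟨fun h ↦ ?_, fun h q hq ↦ ?_⟩
  · by_cases hi : 0 ≤ i
    · lift i to ℕ using hi
      exact (h i rfl).of_iso (K.extendHomologyIso embeddingUpNat rfl ≪≫
        (I.isoRightDerivedObj F i).symm)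
    · rw [← HomologicalComplex.exactAt_iff_isZero_homology]
      exact K.extend_exactAt _ _ (fun q hq ↦ hi (by simp [← hq]))
  · exact h.of_iso (I.isoRightDerivedObj F q ≪≫
      (K.extendHomologyIso embeddingUpNat hq).symm)

end RightDerived

section LongExact

variable {C : Type u} [Category.{v} C] [Abelian C] [EnoughInjectives C]
  {D : Type u'} [Category.{v'} D] [Abelian D] (F : C ⥤ D) [F.Additive]
  {S : ShortComplex C}

lemma ShortComplex.ShortExact.exists_distTriang_rightDerivedVanishes_iff (hS : S.ShortExact) :
    ∃ T ∈ distTriang (HomotopyCategory D (.up ℤ)), ∀ i : ℤ,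
      (F.RightDerivedVanishes i S.X₁ ↔
        IsZero ((HomotopyCategory.homologyFunctor D (.up ℤ) i).obj T.obj₁)) ∧
      (F.RightDerivedVanishes i S.X₂ ↔
        IsZero ((HomotopyCategory.homologyFunctor D (.up ℤ) i).obj T.obj₂)) ∧
      (F.RightDerivedVanishes i S.X₃ ↔
        IsZero ((HomotopyCategory.homologyFunctor D (.up ℤ) i).obj T.obj₃)) := by
  obtain ⟨T, hT, ⟨e₁⟩, ⟨e₂⟩, ⟨e₃⟩⟩ := hS.exists_distTriang_injectiveResolution
    (injectiveResolution _) (injectiveResolution _) (injectiveResolution _)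
  refine ⟨_, (F.mapHomotopyCategory (.up ℤ)).map_distinguished T hT, fun i ↦ ⟨?_, ?_, ?_⟩⟩
  · rw [F.rightDerivedVanishes_iff (injectiveResolution _)]
    exact ((F.mapHomotopyCategoryHomology i).mapIso e₁).symm.isZero_iff
  · rw [F.rightDerivedVanishes_iff (injectiveResolution _)]
    exact ((F.mapHomotopyCategoryHomology i).mapIso e₂).symm.isZero_iff
  · rw [F.rightDerivedVanishes_iff (injectiveResolution _)]
    exact ((F.mapHomotopyCategoryHomology i).mapIso e₃).symm.isZero_iff

variable {F} {i : ℤ}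

lemma ShortComplex.ShortExact.rightDerivedVanishes_X₂ (hS : S.ShortExact)
    (h₁ : F.RightDerivedVanishes i S.X₁) (h₃ : F.RightDerivedVanishes i S.X₃) :
    F.RightDerivedVanishes i S.X₂ := by
  obtain ⟨T, hT, h⟩ := hS.exists_distTriang_rightDerivedVanishes_iff F
  rw [(h i).1] at h₁
  rw [(h i).2.2] at h₃
  rw [(h i).2.1]
  exact ((HomotopyCategory.homologyFunctor D (.up ℤ) 0).homologySequence_exact₂
    T hT i).isZero_of_both_zeros (h₁.eq_of_src _ _) (h₃.eq_of_tgt _ _)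

lemma ShortComplex.ShortExact.rightDerivedVanishes_X₃ (hS : S.ShortExact) {j : ℤ} (hij : i + 1 = j)
    (h₂ : F.RightDerivedVanishes i S.X₂)
    (h₁ : F.RightDerivedVanishes j S.X₁) : F.RightDerivedVanishes i S.X₃ := by
  obtain ⟨T, hT, h⟩ := hS.exists_distTriang_rightDerivedVanishes_iff F
  rw [(h j).1] at h₁
  rw [(h i).2.1] at h₂
  rw [(h i).2.2]
  exact ((HomotopyCategory.homologyFunctor D (.up ℤ) 0).homologySequence_exact₃
    T hT i j hij).isZero_of_both_zeros (h₂.eq_of_src _ _) (h₁.eq_of_tgt _ _)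

lemma ShortComplex.ShortExact.rightDerivedVanishes_X₁ (hS : S.ShortExact) {j : ℤ} (hij : i + 1 = j)
    (h₃ : F.RightDerivedVanishes i S.X₃)
    (h₂ : F.RightDerivedVanishes j S.X₂) : F.RightDerivedVanishes j S.X₁ := by
  obtain ⟨T, hT, h⟩ := hS.exists_distTriang_rightDerivedVanishes_iff F
  rw [(h i).2.2] at h₃
  rw [(h j).2.1] at h₂
  rw [(h j).1]
  exact ((HomotopyCategory.homologyFunctor D (.up ℤ) 0).homologySequence_exact₁
    T hT i j hij).isZero_of_both_zeros (h₃.eq_of_src _ _) (h₂.eq_of_tgt _ _)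

end LongExact

section Boundaries

variable {C : Type u} [Category.{v} C] [Abelian C] (M : CochainComplex C ℤ)

/-- The boundaries in degree `i`, as the kernel of the projection from cycles to homology. -/
noncomputable abbrev _root_.CochainComplex.boundaries (i : ℤ) : C := kernel (M.homologyπ i)

lemma _root_.CochainComplex.shortExact_boundaries_cycles_homology (i : ℤ) :
    (ShortComplex.mk (kernel.ι (M.homologyπ i)) (M.homologyπ i) (by simp)).ShortExact where
  exact := ShortComplex.exact_kernel _

/-- The differential, as a morphism to the boundaries. -/
noncomputable abbrev _root_.CochainComplex.toBoundaries (i j : ℤ) :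
    M.X i ⟶ M.boundaries j :=
  kernel.lift (M.homologyπ j) (M.toCycles i j) (by simp)

lemma _root_.CochainComplex.toBoundaries_ι_iCycles (i j : ℤ) :
    M.toBoundaries i j ≫ kernel.ι (M.homologyπ j) ≫ M.iCycles j = M.d i j := by
  simp

lemma _root_.CochainComplex.shortExact_cycles_X_boundaries {i j : ℤ} (hij : i + 1 = j) :
    (ShortComplex.mk (M.iCycles i) (M.toBoundaries i j) (by
      simp [← cancel_mono (kernel.ι (M.homologyπ j)), ← cancel_mono (M.iCycles j)])).ShortExact
    where
  exact := by
    have h {A : C} (k : A ⟶ M.X i) (hk : k ≫ M.toBoundaries i j = 0) : k ≫ M.d i j = 0 := by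
      rw [← M.toBoundaries_ι_iCycles i j, reassoc_of% hk, zero_comp]
    exact ShortComplex.exact_of_f_is_kernel _ (KernelFork.IsLimit.ofι' _ _ fun k hk ↦
      ⟨M.liftCycles k j (by simp [← hij]) (h k hk), M.liftCycles_i k j _ (h k hk)⟩)
  epi_g := (ShortComplex.exact_iff_epi_kernel_lift _).1
    (ShortComplex.exact_of_g_is_cokernel (.mk (M.toCycles i j) (M.homologyπ j) (by simp))
      (M.homologyIsCokernel i j (by simp [← hij])))

end Boundaries

section Chase

variable {C : Type u} [Category.{v} C] [Abelian C] [EnoughInjectives C]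
  {D : Type u'} [Category.{v'} D] [Abelian D] {F : C ⥤ D} [F.Additive]
  {M : CochainComplex C ℤ} {j : ℤ}

lemma Functor.rightDerivedVanishes_of_isZero {X : C} (hX : IsZero X) (i : ℤ) :
    F.RightDerivedVanishes i X := by
  intro q _
  have := hX.injective
  refine IsZero.of_iso ?_ ((InjectiveResolution.self X).isoRightDerivedObj F q)
  exact (HomologicalComplex.homologyFunctor D _ q).map_isZero
    ((F.mapHomologicalComplex _).map_isZero ((CochainComplex.single₀ C).map_isZero hX))

lemma _root_.CochainComplex.rightDerivedVanishes_cycles {a b : ℤ}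
    (hb : ∀ i, b < i → IsZero (M.X i)) (hX : ∀ t, F.RightDerivedVanishes (j - t) (M.X t))
    (hH : ∀ t, a < t → F.RightDerivedVanishes (j - t - 1) (M.homology t)) (t : ℤ) (ht : a ≤ t) :
    F.RightDerivedVanishes (j - t) (M.cycles t) := by
  obtain h | h := lt_or_ge b t
  · exact F.rightDerivedVanishes_of_isZero ((hb t h).of_mono (M.iCycles t)) _
  · have hZ := rightDerivedVanishes_cycles hb hX hH (t + 1) (by lia)
    have hB : F.RightDerivedVanishes (j - (t + 1)) (M.boundaries (t + 1)) :=
      (M.shortExact_boundaries_cycles_homology (t + 1)).rightDerivedVanishes_X₁ (by lia)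
        (hH (t + 1) (by lia)) hZ
    exact (M.shortExact_cycles_X_boundaries rfl).rightDerivedVanishes_X₁ (by lia) hB (hX t)
termination_by (b + 1 - t).toNat

lemma _root_.CochainComplex.rightDerivedVanishes_boundaries {a b : ℤ}
    (ha : ∀ i, i < a → IsZero (M.X i)) (hX : ∀ t, F.RightDerivedVanishes (j - t) (M.X t))
    (hH : ∀ t, t < b → F.RightDerivedVanishes (j - t + 1) (M.homology t)) (t : ℤ) (ht : t ≤ b) :
    F.RightDerivedVanishes (j - t + 1) (M.boundaries t) := by
  obtain ⟨s, rfl⟩ : ∃ s, t = s + 1 := ⟨t - 1, by lia⟩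
  have hS := M.shortExact_cycles_X_boundaries (i := s) rfl
  obtain h | h := lt_or_ge s a
  · have := hS.epi_g
    exact F.rightDerivedVanishes_of_isZero ((ha s h).of_epi (M.toBoundaries s (s + 1))) _
  · have hB := rightDerivedVanishes_boundaries ha hX hH s (by lia)
    have hZ : F.RightDerivedVanishes (j - s + 1) (M.cycles s) :=
      (M.shortExact_boundaries_cycles_homology s).rightDerivedVanishes_X₂ hB (hH s (by lia))
    rw [show j - (s + 1) + 1 = j - s by lia]
    exact hS.rightDerivedVanishes_X₃ rfl (hX s) hZ
termination_by (t - a).toNat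

end Chase

end CategoryTheory

/-- Let `M : ⋯ → M⁻¹ → M⁰ → M¹ → ⋯` be a bounded complex of
coherent sheaves on `ℙⁿ` with homology sheaves `Fᵗ = Hᵗ(M)`, and fix `j`.  If
`H^{j-t}(Mᵗ) = 0` for all `t`, `H^{j-t-1}(Fᵗ) = 0` for all `t > 0`, and
`H^{j-t+1}(Fᵗ) = 0` for all `t < 0`, then `H^j(F⁰) = 0`.

We formalize this for the right derived functors `Γ.rightDerived q` of any additive
functor `Γ` on an abelian category with enough injectives; sheaf cohomology on `ℙⁿ`
is the case where `Γ` is the global-sections functor on sheaves on `ℙⁿ`.  Cohomology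
in a (possibly negative) integer degree `i` is expressed by quantifying over the
natural numbers `q` with `(q : ℤ) = i`. -/
theorem cohomology_chase {C : Type u} [Category.{v} C] [Abelian C] [EnoughInjectives C]
    {D : Type u'} [Category.{v'} D] [Abelian D]
    (Γ : C ⥤ D) [Γ.Additive]
    (M : CochainComplex C ℤ)
    (hbdd : ∃ a b : ℤ, ∀ i : ℤ, (i < a ∨ b < i) → IsZero (M.X i))
    (j : ℤ)
    (h1 : ∀ (t : ℤ) (q : ℕ), (q : ℤ) = j - t → IsZero ((Γ.rightDerived q).obj (M.X t)))
    (h2 : ∀ t : ℤ, 0 < t → ∀ q : ℕ, (q : ℤ) = j - t - 1 →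
      IsZero ((Γ.rightDerived q).obj (M.homology t)))
    (h3 : ∀ t : ℤ, t < 0 → ∀ q : ℕ, (q : ℤ) = j - t + 1 →
      IsZero ((Γ.rightDerived q).obj (M.homology t)))
    : ∀ q : ℕ, (q : ℤ) = j → IsZero ((Γ.rightDerived q).obj (M.homology 0)) := by
  obtain ⟨a, b, h⟩ := hbdd
  have hZ : Γ.RightDerivedVanishes (j - 0) (M.cycles 0) :=
    CochainComplex.rightDerivedVanishes_cycles (fun i hi ↦ h i (.inr hi)) h1 h2 0 le_rfl
  have hB : Γ.RightDerivedVanishes (j - 0 + 1) (M.boundaries 0) :=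
    CochainComplex.rightDerivedVanishes_boundaries (fun i hi ↦ h i (.inl hi)) h1 h3 0 le_rfl
  rw [sub_zero] at hZ hB
  exact (M.shortExact_boundaries_cycles_homology 0).rightDerivedVanishes_X₃ rfl hZ hB
end

section
/- Let V be an n-dimensional vector space over a field of characteristic zero, let 0 ≤ p ≤ n-1, and let λ, μ be partitions with at most n parts. Then there exists a partition ν such that the Schur module S_ν(V) appears with nonzero multiplicity in S_λ(V) ⊗ S_μ(V) and ν_p ≤ max over k+ℓ=p of (λ_k + μ_ℓ). -/
open MvPolynomial

/-- The alternant `a_α = ∑_{σ ∈ Sₙ} sgn(σ) · ∏ᵢ X_{σ(i)}^{α(i)}` in `n` variables. -/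
noncomputable def alternant (n : ℕ) (α : Fin n → ℕ) : MvPolynomial (Fin n) ℤ :=
  ∑ σ : Equiv.Perm (Fin n),
    ((Equiv.Perm.sign σ : ℤˣ) : ℤ) • ∏ i : Fin n, (X (σ i)) ^ (α i)

/-- `c` records the Littlewood–Richardson expansion `s_λ · s_μ = ∑_ν c^ν_{λμ} s_ν`
of a product of two Schur polynomials in `n` variables, written (after clearing the
Vandermonde denominators, `s_λ = a_{λ+δ}/a_δ` with `δ = (0,1,…,n-1)`) as
`a_{λ+δ} · a_{μ+δ} = ∑_ν c^ν_{λμ} · a_{ν+δ} · a_δ`.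
Partitions are indexed with `λ_0 ≤ λ_1 ≤ ⋯ ≤ λ_{n-1}` (the paper's convention
`λ = (λ_{n-1} ≥ ⋯ ≥ λ_0)`), i.e. they are monotone functions on `Fin n`.
Since such an expansion with coefficients supported on partitions is unique,
`ν ∈ c.support` says exactly that `S_ν(V)` appears with nonzero multiplicity
`c^ν_{λμ}` in `S_λ(V) ⊗ S_μ(V)` for an `n`-dimensional space `V` in
characteristic zero. -/
def IsLRExpansion (n : ℕ) (lam mu : Fin n → ℕ) (c : (Fin n → ℕ) →₀ ℕ) : Prop :=
  (∀ ν ∈ c.support, Monotone ν) ∧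
  alternant n (fun i => lam i + i) * alternant n (fun i => mu i + i) =
    c.sum fun ν m =>
      (m : ℤ) • (alternant n (fun i => ν i + i) * alternant n (fun i => (i : ℕ)))

namespace LittlewoodRichardson

open Finset

variable {n : ℕ}

/-- The monomial `∏ᵢ X_i^{α(i)}`. -/
noncomputable def mon (α : Fin n → ℕ) : MvPolynomial (Fin n) ℤ := ∏ i, X i ^ α i

/-- The signed sum `∑_σ sgn(σ) σ(f)` over all permutations of the variables. -/
noncomputable def antisymm (f : MvPolynomial (Fin n) ℤ) : MvPolynomial (Fin n) ℤ :=
  ∑ σ : Equiv.Perm (Fin n), ((Equiv.Perm.sign σ : ℤˣ) : ℤ) • rename σ f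

lemma alternant_eq_antisymm (α : Fin n → ℕ) : alternant n α = antisymm (mon α) := by
  simp [alternant, antisymm, mon]

lemma antisymm_sum {ι : Type*} (s : Finset ι) (f : ι → MvPolynomial (Fin n) ℤ) :
    antisymm (∑ i ∈ s, f i) = ∑ i ∈ s, antisymm (f i) := by
  simp only [antisymm, map_sum, smul_sum]
  exact sum_comm

lemma antisymm_mul {f g : MvPolynomial (Fin n) ℤ}
    (hg : ∀ σ : Equiv.Perm (Fin n), rename σ g = g) : antisymm (f * g) = antisymm f * g := by
  simp only [antisymm, map_mul, hg, sum_mul, smul_mul_assoc]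

lemma antisymm_rename_swap {i j : Fin n} (hij : i ≠ j) (f : MvPolynomial (Fin n) ℤ) :
    antisymm (rename (Equiv.swap i j) f) = -antisymm f := by
  simp only [antisymm, rename_rename]
  rw [← Equiv.sum_comp (Equiv.mulRight (Equiv.swap i j)), ← sum_neg_distrib]
  refine sum_congr rfl fun σ _ => ?_
  have h : (⇑(σ * Equiv.swap i j) ∘ ⇑(Equiv.swap i j)) = σ := by
    ext x; simp
  rw [Equiv.coe_mulRight, h]
  simp [Equiv.Perm.sign_swap hij]

lemma antisymm_eq_zero {i j : Fin n} (hij : i ≠ j) {f : MvPolynomial (Fin n) ℤ}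
    (hf : rename (Equiv.swap i j) f = f) : antisymm f = 0 := by
  have h := antisymm_rename_swap hij f
  rw [hf] at h
  exact self_eq_neg.mp h

lemma rename_swap_mon {i j : Fin n} {α : Fin n → ℕ} (h : α i = α j) :
    rename (Equiv.swap i j) (mon α) = mon α := by
  simp only [mon, map_prod, map_pow, rename_X]
  rw [← Equiv.prod_comp (Equiv.swap i j)]
  refine prod_congr rfl fun x _ => ?_
  rw [Equiv.swap_apply_self]
  congr 1
  rcases eq_or_ne x i with rfl | hi
  · simp [h]
  rcases eq_or_ne x j with rfl | hj
  · simp [h]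
  · rw [Equiv.swap_apply_of_ne_of_ne hi hj]

/-- The indicator function of `D`. -/
def ind (D : Finset (Fin n)) (i : Fin n) : ℕ := if i ∈ D then 1 else 0

/-- The squarefree monomial `∏_{i ∈ D} X_i`. -/
noncomputable def sqf (D : Finset (Fin n)) : MvPolynomial (Fin n) ℤ := ∏ i ∈ D, X i

lemma mon_mul_sqf (α : Fin n → ℕ) (D : Finset (Fin n)) :
    mon α * sqf D = mon (fun i => α i + ind D i) := by
  have : sqf D = ∏ i, (X i : MvPolynomial (Fin n) ℤ) ^ ind D i := by
    simp [sqf, ind, prod_ite_mem, pow_ite]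
  rw [this, mon, mon, ← prod_mul_distrib]
  simp [pow_add]

/-- The number of elements of `D` that are at least `k`. -/
def topCount (D : Finset (Fin n)) (k : ℕ) : ℕ := #{x ∈ D | k ≤ x.val}

/-- Semistandardness of two neighbouring columns `D` and `D'` (right and left), for the order
of the letters reversed. -/
def ColLE (D D' : Finset (Fin n)) : Prop := ∀ k, topCount D k ≤ topCount D' k

/-- The image of a column under a transposition of letters. -/
def swapCol (i j : Fin n) (D : Finset (Fin n)) : Finset (Fin n) :=
  D.map (Equiv.swap i j).toEmbedding

open Classical in
/-- The generating function of semistandard fillings with prescribed column lengths, added from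
right to left next to the column `D`. -/
noncomputable def colGen : List ℕ → Finset (Fin n) → MvPolynomial (Fin n) ℤ
  | [], _ => 1
  | c :: cs, D => ∑ D' with D'.card = c, if ColLE D D' then sqf D' * colGen cs D' else 0

lemma mem_swapCol {i j x : Fin n} {D : Finset (Fin n)} :
    x ∈ swapCol i j D ↔ Equiv.swap i j x ∈ D := by
  simp [swapCol, mem_map_equiv]

lemma swapCol_swapCol (i j : Fin n) (D : Finset (Fin n)) :
    swapCol i j (swapCol i j D) = D := by
  ext x; simp [mem_swapCol]

lemma card_swapCol (i j : Fin n) (D : Finset (Fin n)) : #(swapCol i j D) = #D := by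
  simp [swapCol]

lemma swapCol_eq_self {i j : Fin n} {D : Finset (Fin n)} (h : i ∈ D ↔ j ∈ D) :
    swapCol i j D = D := by
  ext x
  rw [mem_swapCol]
  rcases eq_or_ne x i with rfl | hi
  · simp [h]
  rcases eq_or_ne x j with rfl | hj
  · simp [h]
  · rw [Equiv.swap_apply_of_ne_of_ne hi hj]

lemma rename_sqf (i j : Fin n) (D : Finset (Fin n)) :
    rename (Equiv.swap i j) (sqf D) = sqf (swapCol i j D) := by
  simp [sqf, swapCol, map_prod]

lemma topCount_eq_ind_add (D : Finset (Fin n)) (i : Fin n) :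
    topCount D i = ind D i + topCount D (i + 1) := by
  have : ({x ∈ D | i.val ≤ x.val} : Finset (Fin n)) =
      {x ∈ D | x = i} ∪ {x ∈ D | i.val + 1 ≤ x.val} := by
    ext x
    simp only [mem_filter, mem_union, Fin.ext_iff]
    constructor
    · rintro ⟨h1, h2⟩
      rcases h2.eq_or_lt with h | h
      · exact Or.inl ⟨h1, h.symm⟩
      · exact Or.inr ⟨h1, h⟩
    · rintro (⟨h1, h2⟩ | ⟨h1, h2⟩)
      · exact ⟨h1, h2.ge⟩
      · exact ⟨h1, by omega⟩
  rw [topCount, this, card_union_of_disjoint, topCount, filter_eq', ind]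
  · split_ifs <;> simp
  · rw [disjoint_filter]
    rintro x - rfl
    omega

lemma topCount_swapCol_of_ne {i j : Fin n} (hij : j.val = i.val + 1) (D : Finset (Fin n)) {k : ℕ}
    (hk : k ≠ j) : topCount (swapCol i j D) k = topCount D k := by
  rw [topCount, swapCol, filter_map, card_map, topCount]
  congr 1
  refine filter_congr fun x _ => ?_
  simp only [Function.comp, Equiv.coe_toEmbedding]
  rcases eq_or_ne x i with rfl | hi
  · rw [Equiv.swap_apply_left, hij]; omega
  rcases eq_or_ne x j with rfl | hj
  · rw [Equiv.swap_apply_right]; omega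
  · rw [Equiv.swap_apply_of_ne_of_ne hi hj]

lemma ind_swapCol_right (i j : Fin n) (D : Finset (Fin n)) : ind (swapCol i j D) j = ind D i := by
  simp [ind, mem_swapCol]

lemma colLE_iff (j : Fin n) {D D' : Finset (Fin n)} :
    ColLE D D' ↔ (∀ k, k ≠ j.val → topCount D k ≤ topCount D' k) ∧
      ind D j + topCount D (j + 1) ≤ ind D' j + topCount D' (j + 1) := by
  rw [← topCount_eq_ind_add, ← topCount_eq_ind_add]
  constructor
  · exact fun h => ⟨fun k _ => h k, h _⟩
  · rintro ⟨h, h'⟩ k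
    rcases eq_or_ne k j.val with rfl | hk
    exacts [h', h k hk]

lemma topCount_pair {i j : Fin n} (hij : j.val = i.val + 1) (D : Finset (Fin n)) :
    topCount D i = ind D i + ind D j + topCount D (j + 1) := by
  rw [topCount_eq_ind_add, ← hij, topCount_eq_ind_add, add_assoc]

/-- Columns that meet `{i, j}` exactly in `j`. -/
def OnlyRight (i j : Fin n) (D : Finset (Fin n)) : Prop := j ∈ D ∧ i ∉ D

lemma colLE_swapCol_right_iff {i j : Fin n} (hij : j.val = i.val + 1) {D D' : Finset (Fin n)}
    (hD : ¬OnlyRight i j D) (hD' : OnlyRight i j D') :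
    ColLE D (swapCol i j D') ↔ ColLE D D' := by
  have hA : (∀ k, k ≠ j.val → topCount D k ≤ topCount (swapCol i j D') k) ↔
      ∀ k, k ≠ j.val → topCount D k ≤ topCount D' k :=
    forall₂_congr fun k hk => by rw [topCount_swapCol_of_ne hij _ hk]
  rw [colLE_iff j, colLE_iff j, hA, ind_swapCol_right,
    topCount_swapCol_of_ne hij _ (by omega)]
  refine and_congr_right fun h => ?_
  have h1 := h i (by omega)
  have h2 := h (j + 1) (by omega)
  rw [topCount_pair hij, topCount_pair hij] at h1
  clear h hA
  simp only [OnlyRight, ind] at *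
  split_ifs at * <;> simp_all <;> omega

lemma colLE_swapCol_left_iff {i j : Fin n} (hij : j.val = i.val + 1) {D D' : Finset (Fin n)}
    (hD : OnlyRight i j D) (hD' : i ∈ D' → j ∈ D') :
    ColLE (swapCol i j D) D' ↔ ColLE D D' := by
  have hA : (∀ k, k ≠ j.val → topCount (swapCol i j D) k ≤ topCount D' k) ↔
      ∀ k, k ≠ j.val → topCount D k ≤ topCount D' k :=
    forall₂_congr fun k hk => by rw [topCount_swapCol_of_ne hij _ hk]
  rw [colLE_iff j, colLE_iff j, hA, ind_swapCol_right,
    topCount_swapCol_of_ne hij _ (by omega)]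
  refine and_congr_right fun h => ?_
  have h1 := h i (by omega)
  have h2 := h (j + 1) (by omega)
  rw [topCount_pair hij, topCount_pair hij] at h1
  clear h hA
  simp only [OnlyRight, ind] at *
  split_ifs at * <;> simp_all <;> omega

lemma ColLE.of_swapCol_right {i j : Fin n} (hij : j.val = i.val + 1) {D D' : Finset (Fin n)}
    (hD' : OnlyRight i j D') (h : ColLE D (swapCol i j D')) : ColLE D D' := by
  have hA : (∀ k, k ≠ j.val → topCount D k ≤ topCount (swapCol i j D') k) ↔
      ∀ k, k ≠ j.val → topCount D k ≤ topCount D' k :=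
    forall₂_congr fun k hk => by rw [topCount_swapCol_of_ne hij _ hk]
  rw [colLE_iff j, hA, ind_swapCol_right, topCount_swapCol_of_ne hij _ (by omega)] at h
  refine (colLE_iff j).2 ⟨h.1, h.2.trans ?_⟩
  simp [ind, hD'.1, hD'.2]

lemma not_onlyRight_swapCol {i j : Fin n} {D : Finset (Fin n)} (h : OnlyRight i j D) :
    ¬OnlyRight i j (swapCol i j D) := by
  simp [OnlyRight, mem_swapCol, h.1, h.2]

lemma sqf_eq_of_onlyRight {i j : Fin n} {D : Finset (Fin n)} (h : OnlyRight i j D) :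
    ∃ y : MvPolynomial (Fin n) ℤ, rename (Equiv.swap i j) y = y ∧
      sqf D = y * X j ∧ sqf (swapCol i j D) = y * X i := by
  have hD : sqf D = sqf (D.erase j) * X j := by
    rw [sqf, sqf, mul_comm, mul_prod_erase _ _ h.1]
  have hy : rename (Equiv.swap i j) (sqf (D.erase j)) = sqf (D.erase j) := by
    rw [rename_sqf, swapCol_eq_self]
    simp [h.2]
  refine ⟨_, hy, hD, ?_⟩
  rw [← rename_sqf, hD, map_mul, hy, rename_X, Equiv.swap_apply_right]

lemma rename_sum_col {i j : Fin n} (c : ℕ) {h : Finset (Fin n) → MvPolynomial (Fin n) ℤ}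
    (hfix : ∀ D, (i ∈ D ↔ j ∈ D) → rename (Equiv.swap i j) (h D) = h D)
    (hright : ∀ D, OnlyRight i j D → rename (Equiv.swap i j) (h D + h (swapCol i j D)) =
      h D + h (swapCol i j D)) :
    rename (Equiv.swap i j) (∑ D with D.card = c, h D) = ∑ D with D.card = c, h D := by
  have hall : ∀ D, rename (Equiv.swap i j) (h D + h (swapCol i j D)) =
      h D + h (swapCol i j D) := by
    intro D
    by_cases hD : i ∈ D ↔ j ∈ D
    · rw [swapCol_eq_self hD, map_add, hfix D hD]
    by_cases hi : i ∈ D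
    · have := hright (swapCol i j D) (by simp_all [OnlyRight, mem_swapCol])
      rwa [swapCol_swapCol, add_comm] at this
    · exact hright D (by simp_all [OnlyRight])
  have hsum : ∑ D with D.card = c, h (swapCol i j D) = ∑ D with D.card = c, h D :=
    sum_nbij' (swapCol i j) (swapCol i j) (by simp [card_swapCol]) (by simp [card_swapCol])
      (by simp [swapCol_swapCol]) (by simp [swapCol_swapCol]) (by simp)
  have h2 : 2 * ∑ D with D.card = c, h D =
      ∑ D with D.card = c, (h D + h (swapCol i j D)) := by
    rw [sum_add_distrib, hsum, two_mul]
  have h3 := congrArg (rename (Equiv.swap i j)) h2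
  rw [map_sum, sum_congr rfl fun D _ => hall D, ← h2, map_mul, map_ofNat] at h3
  exact mul_left_cancel₀ two_ne_zero h3

theorem rename_swap_colGen_aux {i j : Fin n} (hij : j.val = i.val + 1) (cs : List ℕ) :
    (∀ D, ¬OnlyRight i j D → rename (Equiv.swap i j) (colGen cs D) = colGen cs D) ∧
    ∀ D, OnlyRight i j D →
      rename (Equiv.swap i j) (X j * colGen cs D + X i * colGen cs (swapCol i j D)) =
        X j * colGen cs D + X i * colGen cs (swapCol i j D) := by
  classical
  induction cs with
  | nil => simp [colGen, add_comm]
  | cons c cs ih =>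
    obtain ⟨ih1, ih2⟩ := ih
    have hfix : ∀ D', (i ∈ D' ↔ j ∈ D') →
        rename (Equiv.swap i j) (sqf D' * colGen cs D') = sqf D' * colGen cs D' := by
      intro D' hD'
      rw [map_mul, rename_sqf, swapCol_eq_self hD', ih1]
      simp [OnlyRight, hD']
    have hX : rename (Equiv.swap i j) (X j + X i : MvPolynomial (Fin n) ℤ) = X j + X i := by
      simp [add_comm]
    constructor
    · intro D hD
      simp only [colGen]
      refine rename_sum_col c (fun D' hD' => ?_) (fun D' hD' => ?_)
      · split_ifs
        exacts [hfix D' hD', map_zero _]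
      · simp only [colLE_swapCol_right_iff hij hD hD']
        split_ifs
        · obtain ⟨y, hy, h1, h2⟩ := sqf_eq_of_onlyRight hD'
          have := ih2 D' hD'
          rw [h1, h2, mul_assoc, mul_assoc, ← mul_add, map_mul, hy, this]
        · simp
    · intro D hD
      simp only [colGen, mul_sum]
      rw [← sum_add_distrib]
      refine rename_sum_col c (fun D' hD' => ?_) (fun D' hD' => ?_)
      · simp only [colLE_swapCol_left_iff hij hD hD'.1]
        split_ifs
        · rw [← add_mul, map_mul, hX, hfix D' hD']
        · simp
      · have e1 : ColLE (swapCol i j D) D' ↔ ColLE D D' :=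
          colLE_swapCol_left_iff hij hD fun h => absurd h hD'.2
        have e2 : ColLE (swapCol i j D) (swapCol i j D') ↔ ColLE D D' :=
          (colLE_swapCol_right_iff hij (not_onlyRight_swapCol hD) hD').trans e1
        have e3 : ColLE D (swapCol i j D') → ColLE D D' := ColLE.of_swapCol_right hij hD'
        obtain ⟨y, hy, h1, h2⟩ := sqf_eq_of_onlyRight hD'
        have h3 := ih2 D' hD'
        have h4 := ih1 _ (not_onlyRight_swapCol hD')
        simp only [e1, e2]
        by_cases hb : ColLE D D'
        · by_cases hb' : ColLE D (swapCol i j D')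
          · simp only [hb, hb', if_true]
            have : X j * (sqf D' * colGen cs D') + X i * (sqf D' * colGen cs D') +
                (X j * (sqf (swapCol i j D') * colGen cs (swapCol i j D')) +
                  X i * (sqf (swapCol i j D') * colGen cs (swapCol i j D'))) =
                (X j + X i) * y *
                  (X j * colGen cs D' + X i * colGen cs (swapCol i j D')) := by
              rw [h1, h2]; ring
            rw [this, map_mul, map_mul, hX, hy, h3]
          · simp only [hb, hb', if_true, if_false]
            have : X j * (sqf D' * colGen cs D') + X i * (sqf D' * colGen cs D') +
                (X j * 0 + X i * (sqf (swapCol i j D') * colGen cs (swapCol i j D'))) =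
                y * ((X j + X i) * (X j * colGen cs D' + X i * colGen cs (swapCol i j D')) -
                  X i * X j * colGen cs (swapCol i j D')) := by
              rw [h1, h2]; ring
            rw [this, map_mul, hy, map_sub, map_mul, hX, h3, map_mul, h4]
            simp [mul_comm (X i : MvPolynomial (Fin n) ℤ)]
        · simp [hb, mt e3 hb]

lemma rename_swap_colGen {i j : Fin n} (hij : j.val = i.val + 1) (cs : List ℕ)
    {D : Finset (Fin n)} (hD : j ∉ D) :
    rename (Equiv.swap i j) (colGen cs D) = colGen cs D :=
  (rename_swap_colGen_aux hij cs).1 D fun h => hD h.1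

theorem rename_perm_colGen (cs : List ℕ) (σ : Equiv.Perm (Fin n)) :
    rename σ (colGen cs ∅) = (colGen cs ∅ : MvPolynomial (Fin n) ℤ) := by
  obtain _ | n := n
  · rw [Subsingleton.elim σ 1]; simp
  have hσ : σ ∈ Submonoid.closure
      (Set.range fun i : Fin n => Equiv.swap i.castSucc i.succ) := by
    rw [Equiv.Perm.mclosure_swap_castSucc_succ]; trivial
  induction hσ using Submonoid.closure_induction with
  | mem x hx =>
    obtain ⟨i, rfl⟩ := hx
    exact rename_swap_colGen (by simp) cs (by simp)
  | one => simp
  | mul x y _ _ hx hy =>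
    rw [Equiv.Perm.coe_mul, ← rename_rename, hy, hx]

lemma antisymm_mon_mul_colGen_cons (α : Fin n → ℕ) (c : ℕ) (cs : List ℕ) (D : Finset (Fin n))
    [DecidableRel (ColLE (n := n))] :
    antisymm (mon α * colGen (c :: cs) D) = ∑ D' with D'.card = c,
      if ColLE D D' then antisymm (mon (fun i => α i + ind D' i) * colGen cs D') else 0 := by
  rw [colGen, mul_sum, antisymm_sum]
  refine sum_congr rfl fun D' _ => ?_
  split_ifs
  · rw [← mul_assoc, mon_mul_sqf]
  · simp [antisymm]

/-- Adding a column that breaks dominance contributes nothing. -/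
lemma antisymm_eq_zero_of_descent {i j : Fin n} (hij : j.val = i.val + 1) {κ : Fin n → ℕ}
    {D : Finset (Fin n)} (hκ : κ i = κ j) (hi : i ∈ D) (hj : j ∉ D) (cs : List ℕ) :
    antisymm (mon (fun x => κ x + x.val + ind D x) * colGen cs D) = 0 := by
  refine antisymm_eq_zero (i := i) (j := j) (by rintro rfl; omega) ?_
  rw [map_mul, rename_swap_colGen hij cs hj, rename_swap_mon]
  simp [ind, hi, hj, hκ, hij, add_assoc]

/-- The combination `∑_ν c_ν a_{ν+δ}` of alternants. -/
noncomputable def altSum (c : (Fin n → ℕ) →₀ ℕ) : MvPolynomial (Fin n) ℤ :=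
  c.sum fun ν m => (m : ℤ) • alternant n (fun i => ν i + i)

lemma altSum_add (c d : (Fin n → ℕ) →₀ ℕ) : altSum (c + d) = altSum c + altSum d :=
  Finsupp.sum_add_index' (by simp) (by simp [add_mul])

lemma altSum_sum {ι : Type*} (s : Finset ι) (c : ι → (Fin n → ℕ) →₀ ℕ) :
    altSum (∑ i ∈ s, c i) = ∑ i ∈ s, altSum (c i) := by
  classical
  induction s using Finset.induction_on with
  | empty => simp [altSum]
  | insert a s ha ih => rw [sum_insert ha, sum_insert ha, altSum_add, ih]

/-- Nonnegative combinations of the alternants `a_{ν+δ}` with `ν` dominant. -/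
def AltPositive (f : MvPolynomial (Fin n) ℤ) : Prop :=
  ∃ c : (Fin n → ℕ) →₀ ℕ, (∀ ν ∈ c.support, Monotone ν) ∧ f = altSum c

lemma altPositive_zero : AltPositive (0 : MvPolynomial (Fin n) ℤ) :=
  ⟨0, by simp, by simp [altSum]⟩

lemma AltPositive.sum {ι : Type*} (s : Finset ι) {f : ι → MvPolynomial (Fin n) ℤ}
    (h : ∀ i ∈ s, AltPositive (f i)) : AltPositive (∑ i ∈ s, f i) := by
  classical
  induction s using Finset.induction_on with
  | empty => exact altPositive_zero
  | insert a s ha ih =>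
    rw [sum_insert ha]
    obtain ⟨c, hc, hc'⟩ := h a (by simp)
    obtain ⟨d, hd, hd'⟩ := ih fun i hi => h i (by simp [hi])
    refine ⟨c + d, fun ν hν => ?_, by rw [altSum_add, hc', hd']⟩
    rcases mem_union.1 (Finsupp.support_add hν) with h | h
    exacts [hc ν h, hd ν h]

lemma exists_descent {f : Fin n → ℕ} (hf : ¬Monotone f) :
    ∃ i j : Fin n, j.val = i.val + 1 ∧ f j < f i := by
  obtain _ | n := n
  · exact absurd (fun a => a.elim0) hf
  rw [Fin.monotone_iff_le_succ] at hf
  push Not at hf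
  obtain ⟨i, hi⟩ := hf
  exact ⟨i.castSucc, i.succ, by simp, hi⟩

theorem altPositive_antisymm (cs : List ℕ) (κ : Fin n → ℕ) (hκ : Monotone κ)
    (D : Finset (Fin n)) :
    AltPositive (antisymm (mon (fun i => κ i + i.val) * colGen cs D)) := by
  classical
  induction cs generalizing κ D with
  | nil =>
    refine ⟨Finsupp.single κ 1, fun ν hν => ?_, ?_⟩
    · rw [Finsupp.support_single _ (by simp), mem_singleton] at hν
      exact hν ▸ hκ
    · simp [altSum, colGen, alternant_eq_antisymm]
  | cons c cs ih =>
    rw [antisymm_mon_mul_colGen_cons]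
    refine AltPositive.sum _ fun D' _ => ?_
    split_ifs
    swap
    · exact altPositive_zero
    by_cases hm : Monotone fun i => κ i + ind D' i
    · have := ih _ hm D'
      simpa only [add_right_comm] using this
    · obtain ⟨i, j, hij, h⟩ := exists_descent hm
      have h1 := hκ (show i ≤ j from Fin.le_def.2 (by omega))
      have hi : i ∈ D' := by
        by_contra hi
        simp [ind, hi] at h; omega
      have hj : j ∉ D' := by
        intro hj
        simp [ind, hi, hj] at h; omega
      have h2 : κ i = κ j := by
        simp [ind, hi, hj] at h; omega
      rw [antisymm_eq_zero_of_descent hij h2 hi hj]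
      exact altPositive_zero

/-- The set of indices with a part of size at least `m`. -/
def superlevel (mu : Fin n → ℕ) (m : ℕ) : Finset (Fin n) := {x | m ≤ mu x}

/-- The column lengths of the first `m` columns of `mu`, from right to left. -/
def colLens (mu : Fin n → ℕ) : ℕ → List ℕ
  | 0 => []
  | m + 1 => #(superlevel mu (m + 1)) :: colLens mu m

lemma mem_superlevel {mu : Fin n → ℕ} {m : ℕ} {x : Fin n} : x ∈ superlevel mu m ↔ m ≤ mu x := by
  simp [superlevel]

lemma ColLE.subset {D D' : Finset (Fin n)} (hD : IsUpperSet (D : Set (Fin n)))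
    (h : ColLE D D') : D ⊆ D' := by
  intro x hx
  have h1 : ({y ∈ D' | x.val ≤ y.val} : Finset (Fin n)) ⊆ {y ∈ D | x.val ≤ y.val} := by
    intro y hy
    rw [mem_filter] at hy ⊢
    exact ⟨hD (Fin.le_def.2 hy.2) hx, hy.2⟩
  have h2 := eq_of_subset_of_card_le h1 (h x)
  have h3 : x ∈ ({y ∈ D' | x.val ≤ y.val} : Finset (Fin n)) := by
    rw [h2]; simp [hx]
  exact (mem_filter.1 h3).1

lemma eq_of_isUpperSet_of_card_eq {D E : Finset (Fin n)} (hD : IsUpperSet (D : Set (Fin n)))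
    (hE : IsUpperSet (E : Set (Fin n))) (h : #D = #E) : D = E := by
  rcases hD.total hE with h' | h'
  · exact eq_of_subset_of_card_le (coe_subset.1 h') h.ge
  · exact (eq_of_subset_of_card_le (coe_subset.1 h') h.le).symm

lemma isUpperSet_superlevel {mu : Fin n → ℕ} (hmu : Monotone mu) (m : ℕ) :
    IsUpperSet (superlevel mu m : Set (Fin n)) := by
  intro x y hxy hx
  simp only [mem_coe, mem_superlevel] at hx ⊢
  exact hx.trans (hmu hxy)

lemma exists_descent_of_not_isUpperSet {D : Finset (Fin n)}
    (hD : ¬IsUpperSet (D : Set (Fin n))) :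
    ∃ i j : Fin n, j.val = i.val + 1 ∧ i ∈ D ∧ j ∉ D := by
  have hm : ¬Monotone (ind D) := by
    refine mt (fun hm x y hxy hx => ?_) hD
    by_contra hy
    have := hm hxy
    simp only [mem_coe] at hx hy
    simp [ind, hx, hy] at this
  obtain ⟨i, j, hij, h⟩ := exists_descent hm
  refine ⟨i, j, hij, ?_⟩
  simp only [ind] at h
  split_ifs at h <;> simp_all

theorem antisymm_colLens {mu : Fin n → ℕ} (hmu : Monotone mu) (m : ℕ) :
    antisymm (mon (fun i => mu i - m + i.val) *
      colGen (colLens mu m) (superlevel mu (m + 1))) = alternant n (fun i => mu i + i) := by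
  classical
  induction m with
  | zero => simp [colLens, colGen, alternant_eq_antisymm]
  | succ m ih =>
    rw [colLens, antisymm_mon_mul_colGen_cons, sum_eq_single (superlevel mu (m + 1))]
    · have hsub : superlevel mu (m + 1 + 1) ⊆ superlevel mu (m + 1) := fun x => by
        simp only [mem_superlevel]; omega
      have hle : ColLE (superlevel mu (m + 1 + 1)) (superlevel mu (m + 1)) :=
        fun k => card_le_card (filter_subset_filter _ hsub)
      rw [if_pos hle, ← ih]
      congr 3
      ext i
      simp only [ind, mem_superlevel]
      split_ifs <;> omega
    · intro D' hD' hne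
      split_ifs with hle
      swap
      · rfl
      have hup : ¬IsUpperSet (D' : Set (Fin n)) := fun hup =>
        hne (eq_of_isUpperSet_of_card_eq hup (isUpperSet_superlevel hmu _) (by simpa using hD'))
      obtain ⟨i, j, hij, hi, hj⟩ := exists_descent_of_not_isUpperSet hup
      have hj' : j ∉ superlevel mu (m + 1 + 1) :=
        fun h => hj (hle.subset (isUpperSet_superlevel hmu _) h)
      have h1 := hmu (show i ≤ j from Fin.le_def.2 (by omega))
      rw [mem_superlevel] at hj'
      exact antisymm_eq_zero_of_descent (κ := fun i => mu i - (m + 1)) hij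
        (by omega) hi hj _
    · simp

/-- Existence of Schur polynomials, and positivity of their products with alternants. -/
theorem exists_schur {mu : Fin n → ℕ} (hmu : Monotone mu) :
    ∃ s : MvPolynomial (Fin n) ℤ,
      alternant n (fun i => (i : ℕ)) * s = alternant n (fun i => mu i + i) ∧
      ∀ lam : Fin n → ℕ, Monotone lam → AltPositive (alternant n (fun i => lam i + i) * s) := by
  set N := ∑ i, mu i with hN
  have hle : ∀ i, mu i ≤ N := fun i =>
    single_le_sum (f := mu) (fun _ _ => Nat.zero_le _) (mem_univ i)
  have hmul : ∀ α : Fin n → ℕ, antisymm (mon α * colGen (colLens mu N) ∅) =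
      alternant n α * colGen (colLens mu N) ∅ := fun α => by
    rw [antisymm_mul (rename_perm_colGen _), alternant_eq_antisymm]
  refine ⟨colGen (colLens mu N) ∅, ?_, fun lam hlam => ?_⟩
  · rw [← hmul, ← antisymm_colLens hmu N]
    have h1 : superlevel mu (N + 1) = ∅ := by
      ext x
      simp only [mem_superlevel, notMem_empty, iff_false]
      have := hle x
      omega
    have h2 : (fun i : Fin n => mu i - N + i.val) = fun i => i.val := by
      ext x
      have := hle x
      omega
    rw [h1, h2]
  · rw [← hmul]
    exact altPositive_antisymm _ _ hlam _

lemma isLRExpansion_iff {lam mu : Fin n → ℕ} {c : (Fin n → ℕ) →₀ ℕ} :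
    IsLRExpansion n lam mu c ↔ (∀ ν ∈ c.support, Monotone ν) ∧
      alternant n (fun i => lam i + i) * alternant n (fun i => mu i + i) =
        altSum c * alternant n (fun i => (i : ℕ)) := by
  simp only [IsLRExpansion, altSum, Finsupp.sum, sum_mul, smul_mul_assoc]

theorem exists_isLRExpansion {lam mu : Fin n → ℕ} (hlam : Monotone lam) (hmu : Monotone mu) :
    ∃ c, IsLRExpansion n lam mu c := by
  obtain ⟨s, hs, hpos⟩ := exists_schur hmu
  obtain ⟨c, hc, hc'⟩ := hpos lam hlam
  exact ⟨c, isLRExpansion_iff.2 ⟨hc, by rw [← hs, ← hc']; ring⟩⟩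

lemma mon_eq_monomial (α : Fin n → ℕ) :
    mon α = monomial (Finsupp.equivFunOnFinite.symm α) 1 := by
  rw [monomial_eq, Finsupp.prod_fintype _ _ (by simp)]
  simp [mon]

lemma alternant_eq_sum_mon (α : Fin n → ℕ) :
    alternant n α = ∑ σ : Equiv.Perm (Fin n),
      ((Equiv.Perm.sign σ : ℤˣ) : ℤ) • mon (fun i => α (σ i)) := by
  rw [alternant, ← Equiv.sum_comp (Equiv.inv (Equiv.Perm (Fin n)))]
  refine sum_congr rfl fun σ _ => ?_
  rw [mon, ← Equiv.prod_comp σ]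
  simp

lemma coeff_mon (e α : Fin n → ℕ) :
    coeff (Finsupp.equivFunOnFinite.symm e) (mon α) = if α = e then 1 else 0 := by
  classical
  rw [mon_eq_monomial, coeff_monomial]
  simp

lemma coeff_alternant (e α : Fin n → ℕ) :
    coeff (Finsupp.equivFunOnFinite.symm e) (alternant n α) = ∑ σ : Equiv.Perm (Fin n),
      if (fun i => α (σ i)) = e then ((Equiv.Perm.sign σ : ℤˣ) : ℤ) else 0 := by
  rw [alternant_eq_sum_mon, coeff_sum]
  refine sum_congr rfl fun σ _ => ?_
  rw [coeff_smul, coeff_mon]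
  simp

lemma exists_perm_of_coeff_alternant_ne_zero {e α : Fin n → ℕ}
    (h : coeff (Finsupp.equivFunOnFinite.symm e) (alternant n α) ≠ 0) :
    ∃ σ : Equiv.Perm (Fin n), ∀ i, α (σ i) = e i := by
  rw [coeff_alternant] at h
  obtain ⟨σ, -, hσ⟩ := exists_ne_zero_of_sum_ne_zero h
  exact ⟨σ, congrFun (by_contra fun h' => hσ (if_neg h'))⟩

lemma coeff_alternant_of_strictMono {e α : Fin n → ℕ} (he : StrictMono e) (hα : StrictMono α) :
    coeff (Finsupp.equivFunOnFinite.symm e) (alternant n α) = if α = e then 1 else 0 := by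
  split_ifs with h
  · subst h
    rw [coeff_alternant, sum_eq_single 1]
    · simp
    · intro σ _ hσ
      refine if_neg fun h => hσ ?_
      ext i
      simpa using congrArg Fin.val (hα.injective (congrFun h i))
    · simp
  · by_contra h'
    obtain ⟨σ, hσ⟩ := exists_perm_of_coeff_alternant_ne_zero h'
    refine h (hα.range_inj he |>.1 ?_)
    rw [← funext hσ]
    exact (σ.surjective.range_comp α).symm

lemma strictMono_add_val {ν : Fin n → ℕ} (hν : Monotone ν) : StrictMono fun i => ν i + i.val :=
  hν.add_strictMono Fin.val_strictMono

lemma alternant_val_ne_zero : alternant n (fun i => (i : ℕ)) ≠ 0 := by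
  intro h
  have := coeff_alternant_of_strictMono (n := n) Fin.val_strictMono Fin.val_strictMono
  simp [h] at this

lemma coeff_altSum {c : (Fin n → ℕ) →₀ ℕ} (hc : ∀ ν ∈ c.support, Monotone ν) {κ : Fin n → ℕ}
    (hκ : Monotone κ) :
    coeff (Finsupp.equivFunOnFinite.symm fun i => κ i + i.val) (altSum c) = c κ := by
  rw [altSum, Finsupp.sum, coeff_sum]
  have : ∀ ν ∈ c.support, coeff (Finsupp.equivFunOnFinite.symm fun i => κ i + i.val)
      ((c ν : ℤ) • alternant n (fun i => ν i + i)) = if ν = κ then (c ν : ℤ) else 0 := by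
    intro ν hν
    rw [coeff_smul, coeff_alternant_of_strictMono (strictMono_add_val hκ)
      (strictMono_add_val (hc ν hν))]
    have : (fun i : Fin n => ν i + i.val) = (fun i => κ i + i.val) ↔ ν = κ := by
      simp [funext_iff]
    simp [this]
  rw [sum_congr rfl this]
  simp +contextual

/-- Pieri's rule for multiplication by the sum of the variables. -/
lemma alternant_mul_sum_X (α : Fin n → ℕ) :
    alternant n α * ∑ x, X x = ∑ x, alternant n (fun i => α i + ind {x} i) := by
  simp only [alternant_eq_antisymm]
  rw [← antisymm_mul (fun σ => by simp [Equiv.sum_comp σ fun x => (X x : MvPolynomial (Fin n) ℤ)]),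
    mul_sum, antisymm_sum]
  simp [← mon_mul_sqf, sqf]

lemma apply_le_of_perm {f : Fin n → ℕ} (hf : Monotone f) (σ : Equiv.Perm (Fin n)) {p : Fin n}
    {B : ℕ} (h : ∀ i ≤ p, f (σ i) ≤ B) : f p ≤ B := by
  obtain ⟨i, hi, hpi⟩ : ∃ i ≤ p, p ≤ σ i := by
    by_contra! hlt
    have := card_le_card_of_injOn σ (s := Iic p) (t := Iio p)
      (fun i hi => by simpa using hlt i (by simpa using hi)) σ.injective.injOn
    simp at this
  exact (hf hpi).trans (h i hi)

/-- Some constituent of the product of `s_lam` and `s_mu` has `p`-th part at most `M`. -/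
def HasSmallConstituent (p : Fin n) (M : ℕ) (lam mu : Fin n → ℕ) : Prop :=
  ∃ c, IsLRExpansion n lam mu c ∧ ∃ ν ∈ c.support, ν p ≤ M

lemma HasSmallConstituent.of_add_box {p : Fin n} {M : ℕ} {lam mu : Fin n → ℕ}
    (hlam : Monotone lam) (hmu : Monotone mu) {i : Fin n}
    (h : HasSmallConstituent p M lam fun x => mu x + ind {i} x) :
    HasSmallConstituent p M lam mu := by
  obtain ⟨c', hc', κ, hκ, hκp⟩ := h
  rw [isLRExpansion_iff] at hc'
  obtain ⟨c, hc⟩ := exists_isLRExpansion hlam hmu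
  refine ⟨c, hc, ?_⟩
  rw [isLRExpansion_iff] at hc
  have hd : ∀ x : Fin n, ∃ d : (Fin n → ℕ) →₀ ℕ, (∀ ν ∈ d.support, Monotone ν) ∧
      alternant n (fun i => lam i + i) * alternant n (fun y => mu y + y + ind {x} y) =
        altSum d * alternant n (fun i => (i : ℕ)) := by
    intro x
    by_cases hm : Monotone fun y => mu y + ind {x} y
    · obtain ⟨d, hd⟩ := exists_isLRExpansion hlam hm
      rw [isLRExpansion_iff] at hd
      simp only [add_right_comm _ _ (ind _ _)]
      exact ⟨d, hd⟩
    · obtain ⟨a, b, hab, hlt⟩ := exists_descent hm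
      have h1 := hmu (show a ≤ b from Fin.le_def.2 (by omega))
      have ha : a ∈ ({x} : Finset (Fin n)) := by
        by_contra ha
        simp only [ind, ha, if_false] at hlt; omega
      have hb : b ∉ ({x} : Finset (Fin n)) := by
        intro hb
        simp only [ind, ha, hb, if_true] at hlt; omega
      have h2 : mu a = mu b := by
        simp only [ind, ha, hb, if_true, if_false] at hlt; omega
      have h3 := antisymm_eq_zero_of_descent hab h2 ha hb []
      rw [colGen, mul_one, ← alternant_eq_antisymm] at h3
      exact ⟨0, by simp, by rw [h3]; simp [altSum]⟩
  choose d hdm hd using hd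
  have hdi : altSum (d i) * alternant n (fun i => (i : ℕ)) =
      altSum c' * alternant n (fun i => (i : ℕ)) := by
    rw [← hd, ← hc'.2]
    simp only [add_right_comm _ _ (ind _ _)]
  replace hdi := mul_right_cancel₀ alternant_val_ne_zero hdi
  have hκm := hc'.1 κ hκ
  have hdκ : d i κ ≠ 0 := by
    have := coeff_altSum (hdm i) hκm
    rw [hdi, coeff_altSum hc'.1 hκm] at this
    rw [Finsupp.mem_support_iff] at hκ
    exact_mod_cast this ▸ (Nat.cast_ne_zero (R := ℤ)).2 hκ
  have hsum : altSum c * ∑ x, X x = altSum (∑ x, d x) := by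
    refine mul_right_cancel₀ alternant_val_ne_zero ?_
    rw [altSum_sum, sum_mul, ← sum_congr rfl fun x _ => hd x, ← mul_sum, ← alternant_mul_sum_X,
      ← mul_assoc, hc.2]
    ring
  have hne : coeff (Finsupp.equivFunOnFinite.symm fun i => κ i + i.val)
      (altSum c * ∑ x, X x) ≠ 0 := by
    rw [hsum, altSum_sum, coeff_sum, sum_congr rfl fun x _ => coeff_altSum (hdm x) hκm]
    refine (sum_pos' (fun _ _ => by positivity) ⟨i, mem_univ _, by positivity⟩).ne'
  rw [altSum, Finsupp.sum, sum_mul, coeff_sum] at hne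
  obtain ⟨ν, hν, hne⟩ := exists_ne_zero_of_sum_ne_zero hne
  rw [smul_mul_assoc, coeff_smul, alternant_mul_sum_X, coeff_sum] at hne
  obtain ⟨x, -, hne⟩ := exists_ne_zero_of_sum_ne_zero (right_ne_zero_of_smul hne)
  obtain ⟨σ, hσ⟩ := exists_perm_of_coeff_alternant_ne_zero hne
  refine ⟨ν, hν, ?_⟩
  have := apply_le_of_perm (strictMono_add_val (hc.1 ν hν)).monotone σ (p := p) (B := κ p + p)
    fun q hq => by
      have h1 := hσ q
      have h2 := hκm hq
      have h3 := Fin.le_def.1 hq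
      omega
  omega

lemma HasSmallConstituent.of_le {p : Fin n} {M : ℕ} {lam mu mu' : Fin n → ℕ}
    (hlam : Monotone lam) (hmu : Monotone mu) (hmu' : Monotone mu') (hle : ∀ i, mu i ≤ mu' i)
    (h : HasSmallConstituent p M lam mu') : HasSmallConstituent p M lam mu := by
  induction hk : ∑ i, (mu' i - mu i) using Nat.strong_induction_on generalizing mu with
  | _ k ih =>
    by_cases heq : mu = mu'
    · exact heq ▸ h
    have hne : ({i | mu i < mu' i} : Finset (Fin n)).Nonempty := by
      obtain ⟨i, hi⟩ := Function.ne_iff.1 heq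
      exact ⟨i, by simpa using (hle i).lt_of_ne hi⟩
    obtain ⟨i, hi, hmax⟩ := exists_max_image _ id hne
    simp only [mem_filter_univ, id] at hi hmax
    have hind : ∀ x, ind {i} x = if x = i then 1 else 0 := by simp [ind]
    refine of_add_box hlam hmu (i := i) (ih _ ?_ ?_ ?_ rfl)
    · rw [← hk]
      refine sum_lt_sum (fun x _ => by omega) ⟨i, mem_univ _, ?_⟩
      rw [hind]; simp only [if_true]; omega
    · intro a b hab
      have h1 := hmu hab
      have h2 := hmu' hab
      simp only [hind]
      rcases eq_or_ne a i with rfl | ha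
      · rcases eq_or_ne b a with rfl | hb
        · exact le_rfl
        · have h3 : ¬mu b < mu' b := fun h3 => hb (le_antisymm (hmax b h3) hab)
          simp only [hb, if_true, if_false]; omega
      · simp only [ha, if_false]; omega
    · intro x
      have := hle x
      rw [hind]
      split_ifs with hx
      · subst hx; omega
      · omega

lemma coeff_alternant_mul_alternant (e α β : Fin n → ℕ) :
    coeff (Finsupp.equivFunOnFinite.symm e) (alternant n α * alternant n β) =
      ∑ σ : Equiv.Perm (Fin n), ∑ τ : Equiv.Perm (Fin n),
        if ∀ i, α (σ i) + β (τ i) = e i then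
          ((Equiv.Perm.sign σ : ℤˣ) : ℤ) * ((Equiv.Perm.sign τ : ℤˣ) : ℤ) else 0 := by
  have hmul : ∀ a b : Fin n → ℕ, mon a * mon b = mon fun i => a i + b i := fun a b => by
    simp [mon, pow_add, prod_mul_distrib]
  rw [alternant_eq_sum_mon, alternant_eq_sum_mon, sum_mul_sum, coeff_sum]
  refine sum_congr rfl fun σ _ => ?_
  rw [coeff_sum]
  refine sum_congr rfl fun τ _ => ?_
  rw [smul_mul_smul_comm, hmul, coeff_smul, coeff_mon]
  simp [funext_iff]

/-- The permutation that reverses the initial segment up to `p`. -/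
def initialRev (p : Fin n) : Equiv.Perm (Fin n) :=
  Function.Involutive.toPerm
    (fun i => if i ≤ p then ⟨p.val - i.val, lt_of_le_of_lt (Nat.sub_le _ _) p.isLt⟩ else i) <| by
    intro i
    by_cases hi : i ≤ p
    · have h : (⟨p.val - i.val, lt_of_le_of_lt (Nat.sub_le _ _) p.isLt⟩ : Fin n) ≤ p :=
        Fin.le_def.2 (Nat.sub_le _ _)
      have := Fin.le_def.1 hi
      simp only [hi, h, if_true]
      ext
      dsimp only
      omega
    · simp [hi]

lemma initialRev_apply (p i : Fin n) : initialRev p i =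
    if i ≤ p then ⟨p.val - i.val, lt_of_le_of_lt (Nat.sub_le _ _) p.isLt⟩ else i := rfl

lemma initialRev_of_le {p i : Fin n} (h : i ≤ p) : (initialRev p i).val = p.val - i.val := by
  rw [initialRev_apply, if_pos h]

lemma initialRev_of_lt {p i : Fin n} (h : p < i) : initialRev p i = i := by
  rw [initialRev_apply, if_neg (not_le.2 h)]

/-- If `α` and `β` have complementary initial segments, only one pairing of their entries
contributes to the monomial that is extremal above `p` and constant up to `p`. -/
lemma coeff_alternant_mul_alternant_ne_zero {p : Fin n} {B : ℕ} {α β : Fin n → ℕ}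
    (hα : StrictMono α) (hβ : StrictMono β) (h : ∀ i ≤ p, α i + β (initialRev p i) = B) :
    coeff (Finsupp.equivFunOnFinite.symm fun i => if i ≤ p then B else α i + β i)
      (alternant n α * alternant n β) ≠ 0 := by
  set e : Fin n → ℕ := fun i => if i ≤ p then B else α i + β i with he
  have hw : ∀ i, α i + β (initialRev p i) = e i := by
    intro i
    rcases le_or_gt i p with hi | hi
    · simp [he, hi, h i hi]
    · simp [he, not_le.2 hi, initialRev_of_lt hi]
  have hsol : ∀ σ τ : Equiv.Perm (Fin n), (∀ i, α (σ i) + β (τ i) = e i) →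
      τ = initialRev p * σ := by
    intro σ τ hστ
    have hfix : ∀ i, p < i → σ i = i ∧ τ i = i := by
      intro i
      induction i using WellFoundedGT.induction with
      | _ i ih =>
        intro hi
        have hσi : σ i ≤ i := by
          by_contra! hlt
          exact hlt.ne' (σ.injective (ih _ hlt (hi.trans hlt)).1)
        have hτi : τ i ≤ i := by
          by_contra! hlt
          exact hlt.ne' (τ.injective (ih _ hlt (hi.trans hlt)).2)
        have h1 := hα.monotone hσi
        have h2 := hβ.monotone hτi
        have h3 := hστ i
        simp only [he, not_le.2 hi, if_false] at h3
        exact ⟨hα.injective (by omega), hβ.injective (by omega)⟩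
    have heσ : ∀ i, e (σ i) = e i := by
      intro i
      rcases le_or_gt i p with hi | hi
      · have : σ i ≤ p := by
          by_contra! hlt
          have := σ.injective (hfix _ hlt).1
          rw [this] at hlt
          exact absurd hi (not_le.2 hlt)
        simp [he, hi, this]
      · rw [(hfix i hi).1]
    ext i
    have h1 := hw (σ i)
    have h2 := hστ i
    rw [heσ] at h1
    rw [hβ.injective (show β (τ i) = β (initialRev p (σ i)) by omega)]
    rfl
  rw [coeff_alternant_mul_alternant]
  have hterm : ∀ σ τ : Equiv.Perm (Fin n), (if ∀ i, α (σ i) + β (τ i) = e i then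
      ((Equiv.Perm.sign σ : ℤˣ) : ℤ) * ((Equiv.Perm.sign τ : ℤˣ) : ℤ) else 0) =
      ((Equiv.Perm.sign (initialRev p) : ℤˣ) : ℤ) *
        if ∀ i, α (σ i) + β (τ i) = e i then 1 else 0 := by
    intro σ τ
    split_ifs with hστ
    · rw [hsol σ τ hστ, ← Units.val_mul, map_mul, mul_one, mul_left_comm, Int.units_mul_self,
        mul_one]
    · simp
  simp only [hterm, ← mul_sum]
  refine mul_ne_zero (Units.ne_zero _) (ne_of_gt ?_)
  refine sum_pos' (fun σ _ => sum_nonneg fun τ _ => by positivity) ⟨1, mem_univ _, ?_⟩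
  exact sum_pos' (fun τ _ => by positivity) ⟨initialRev p, mem_univ _, by simp [hw]⟩

theorem hasSmallConstituent_of_complementary {p : Fin n} {M : ℕ} {lam mu : Fin n → ℕ}
    (hlam : Monotone lam) (hmu : Monotone mu)
    (h : ∀ i ≤ p, lam i + mu (initialRev p i) = M) : HasSmallConstituent p M lam mu := by
  obtain ⟨c, hc⟩ := exists_isLRExpansion hlam hmu
  refine ⟨c, hc, ?_⟩
  have hne := coeff_alternant_mul_alternant_ne_zero (p := p) (B := M + p)
    (strictMono_add_val hlam) (strictMono_add_val hmu) fun i hi => by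
      have h1 := h i hi
      have h2 := initialRev_of_le hi
      have h3 := Fin.le_def.1 hi
      omega
  rw [hc.2, Finsupp.sum, coeff_sum] at hne
  obtain ⟨ν, hν, hne⟩ := exists_ne_zero_of_sum_ne_zero hne
  rw [coeff_smul] at hne
  replace hne := right_ne_zero_of_smul hne
  rw [coeff_alternant_mul_alternant] at hne
  obtain ⟨σ, -, hne⟩ := exists_ne_zero_of_sum_ne_zero hne
  obtain ⟨τ, -, hne⟩ := exists_ne_zero_of_sum_ne_zero hne
  have hστ := by_contra fun h' => hne (if_neg h')
  refine ⟨ν, hν, ?_⟩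
  have := apply_le_of_perm (strictMono_add_val (hc.1 ν hν)).monotone σ (p := p) (B := M + p)
    fun q hq => by
      have h1 := hστ q
      rw [if_pos hq] at h1
      exact (Nat.le_add_right _ _).trans h1.le
  omega

theorem hasSmallConstituent_of_forall_le {p : Fin n} {M : ℕ} {lam mu : Fin n → ℕ}
    (hlam : Monotone lam) (hmu : Monotone mu)
    (h : ∀ i ≤ p, lam i + mu (initialRev p i) ≤ M) : HasSmallConstituent p M lam mu := by
  have hrev : ∀ i ≤ p, initialRev p i ≤ p := fun i hi =>
    Fin.le_def.2 (by rw [initialRev_of_le hi]; omega)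
  have hinv : ∀ i, initialRev p (initialRev p i) = i := fun i =>
    Function.Involutive.toPerm_involutive _ i
  have hle : ∀ i ≤ p, mu i ≤ M - lam (initialRev p i) := fun i hi => by
    have := h _ (hrev i hi)
    rw [hinv] at this
    omega
  set mu' : Fin n → ℕ := fun i => if i ≤ p then M - lam (initialRev p i) else max M (mu i)
    with hmu'
  have hmono : Monotone mu' := by
    intro a b hab
    have h1 := hmu hab
    simp only [hmu']
    rcases le_or_gt b p with hb | hb
    · have h2 : initialRev p b ≤ initialRev p a := Fin.le_def.2 <| by
        rw [initialRev_of_le hb, initialRev_of_le (hab.trans hb)]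
        have := Fin.le_def.1 hab
        omega
      have h3 := hlam h2
      rw [if_pos hb, if_pos (hab.trans hb)]
      omega
    · rw [if_neg (not_le.2 hb)]
      split_ifs <;> omega
  refine .of_le hlam hmu hmono (fun i => ?_)
    (hasSmallConstituent_of_complementary hlam hmono fun i hi => ?_)
  · simp only [hmu']
    split_ifs with hi
    exacts [hle i hi, le_max_right _ _]
  · have := h i hi
    simp only [hmu', hrev i hi, if_true, hinv]
    omega

end LittlewoodRichardson

open LittlewoodRichardson in
/-- Let `V` be an `n`-dimensional vector space over a field of
characteristic zero, `0 ≤ p ≤ n-1`, and `λ, μ` partitions with at most `n` parts.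
Then some Schur module `S_ν(V)` appears with nonzero multiplicity in
`S_λ(V) ⊗ S_μ(V)` with `ν_p ≤ max_{k+ℓ=p} (λ_k + μ_ℓ)` (the maximum being
witnessed by some decomposition `p = k + ℓ`). -/
theorem exists_small_partition_in_tensor (n p : ℕ) (hp : p < n)
    (lam mu : Fin n → ℕ) (hlam : Monotone lam) (hmu : Monotone mu) :
    ∃ c : (Fin n → ℕ) →₀ ℕ, IsLRExpansion n lam mu c ∧
      ∃ ν ∈ c.support, ∃ k ℓ : Fin n, (k : ℕ) + (ℓ : ℕ) = p ∧
        ν ⟨p, hp⟩ ≤ lam k + mu ℓ := by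
  obtain ⟨i, hi, hmax⟩ := Finset.exists_max_image (Finset.Iic (⟨p, hp⟩ : Fin n))
    (fun i => lam i + mu (initialRev ⟨p, hp⟩ i)) ⟨⟨p, hp⟩, by simp⟩
  simp only [Finset.mem_Iic] at hi hmax
  obtain ⟨c, hc, ν, hν, hle⟩ := hasSmallConstituent_of_forall_le hlam hmu hmax
  refine ⟨c, hc, ν, hν, i, initialRev ⟨p, hp⟩ i, ?_, hle⟩
  rw [initialRev_of_le hi]
  have := Fin.le_def.1 hi
  dsimp only at this ⊢
  omega
end

section
/- Let λ and μ be partitions with n parts, let 0 ≤ p ≤ n-1, and let λ' = (λ_p, ..., λ_0), μ' = (μ_p, ..., μ_0) be their truncations to the lowest p+1 parts. If the Littlewood–Richardson coefficient c^{ν'}_{λ'μ'} is nonzero for some partition ν' with p+1 parts, then c^{ν}_{λμ} is nonzero for ν = (λ_{n-1}+μ_{n-1}, ..., λ_{p+1}+μ_{p+1}, ν'_p, ..., ν'_0). -/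
open MvPolynomial

namespace GelfandTsetlin

/-- Gelfand–Tsetlin patterns of shape `sh`, encoding the semistandard tableaux with rows
`1, …, n` of lengths `sh 1 ≤ ⋯ ≤ sh n` and letters `0, …, n - 1`, whose rows are weakly decreasing
and whose columns are strictly increasing in the row index: `g i k` is the number of letters
`≥ k` in row `i`. Rows beyond `n` are given the constant value `sh i`. -/
structure IsPattern (n : ℕ) (sh : ℕ → ℕ) (g : ℕ → ℕ → ℕ) : Prop where
  outer : ∀ i k, n < i → g i k = sh i
  left : ∀ i, g i 0 = sh i
  tri : ∀ i k, i ≤ n → i ≤ k → g i k = 0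
  anti : ∀ i k, g i (k + 1) ≤ g i k
  diag : ∀ i k, g i k ≤ g (i + 1) (k + 1)

/-- The number of letters `k` in the columns `≥ j` (numbered from `0`). -/
def wt (n : ℕ) (g : ℕ → ℕ → ℕ) (j k : ℕ) : ℕ :=
  ∑ i ∈ Finset.range (n + 1), (max (g i k) j - max (g i (k + 1)) j)

/-- Dominance of `mu` plus the weight of the columns `≥ j`, for every `j`. -/
def IsGood (n : ℕ) (mu : ℕ → ℕ) (g : ℕ → ℕ → ℕ) : Prop :=
  ∀ j k, k + 1 < n → mu k + wt n g j k ≤ mu (k + 1) + wt n g j (k + 1)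

/-- The Bender–Knuth involution exchanging the letters `k` and `k + 1`, applied to the
columns `< j`. -/
def toggle (n j k : ℕ) (g : ℕ → ℕ → ℕ) : ℕ → ℕ → ℕ := fun i m =>
  if m = k + 1 ∧ i ≤ n ∧ g i (k + 1) ≤ j then
    min (min (g i k) (g (i + 1) (k + 2))) j + max (g (i - 1) k) (g i (k + 2)) - g i (k + 1)
  else g i m

variable {n : ℕ} {sh mu : ℕ → ℕ} {g : ℕ → ℕ → ℕ}

namespace IsPattern

lemma le_shape (hg : IsPattern n sh g) (i k : ℕ) : g i k ≤ sh i := by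
  induction k with
  | zero => exact (hg.left i).le
  | succ k ih => exact (hg.anti i k).trans ih

lemma shape_monotone (hg : IsPattern n sh g) : Monotone sh :=
  monotone_nat_of_le_succ fun i => by
    rw [← hg.left i]
    exact (hg.diag i 0).trans (hg.le_shape _ _)

lemma pred_le (hg : IsPattern n sh g) (i k : ℕ) : g (i - 1) k ≤ g i (k + 1) := by
  cases i with
  | zero => simp [hg.tri 0 k (by omega) (by omega)]
  | succ i => exact hg.diag i k

lemma wt_add (hg : IsPattern n sh g) (j k : ℕ) :
    wt n g j k + ∑ i ∈ Finset.range (n + 1), max (g i (k + 1)) j =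
      ∑ i ∈ Finset.range (n + 1), max (g i k) j := by
  rw [wt, ← Finset.sum_add_distrib]
  refine Finset.sum_congr rfl fun i _ => ?_
  have := hg.anti i k
  omega

lemma sum_wt_add (hg : IsPattern n sh g) (j m : ℕ) :
    ∑ k ∈ Finset.range m, wt n g j k + ∑ i ∈ Finset.range (n + 1), max (g i m) j =
      ∑ i ∈ Finset.range (n + 1), max (sh i) j := by
  induction m with
  | zero => simp [hg.left]
  | succ m ih =>
    rw [Finset.sum_range_succ]
    have := hg.wt_add j m
    omega

lemma wt_eq_zero (hg : IsPattern n sh g) {j : ℕ} (hj : sh n ≤ j) (k : ℕ) : wt n g j k = 0 := by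
  refine Finset.sum_eq_zero fun i hi => ?_
  have h1 := hg.le_shape i k
  have h2 := hg.shape_monotone (Nat.lt_succ_iff.mp (Finset.mem_range.mp hi))
  omega

lemma toggle_bounds (hg : IsPattern n sh g) (j k i : ℕ) :
    g (i - 1) k ≤ toggle n j k g i (k + 1) ∧ g i (k + 2) ≤ toggle n j k g i (k + 1) ∧
      toggle n j k g i (k + 1) ≤ g i k ∧ toggle n j k g i (k + 1) ≤ g (i + 1) (k + 2) := by
  have h1 := hg.pred_le i k
  have h2 := hg.anti i k
  have h3 : g i (k + 2) ≤ g i (k + 1) := hg.anti i (k + 1)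
  have h4 : g i (k + 1) ≤ g (i + 1) (k + 2) := hg.diag i (k + 1)
  simp only [toggle]
  split_ifs <;> omega

lemma toggle_isPattern (hg : IsPattern n sh g) (j : ℕ) {k : ℕ} (hk : k + 1 < n) :
    IsPattern n sh (toggle n j k g) := by
  have hne : ∀ i m, m ≠ k + 1 → toggle n j k g i m = g i m := fun i m hm => by
    simp [toggle, hm]
  have hb := hg.toggle_bounds j k
  refine ⟨fun i m hi => ?_, fun i => ?_, fun i m hi him => ?_, fun i m => ?_, fun i m => ?_⟩
  · rw [toggle, if_neg (by omega), hg.outer i m hi]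
  · rw [hne _ _ (by omega), hg.left]
  · by_cases hm : m = k + 1
    · subst hm
      rcases him.lt_or_eq with h | h
      · have := hg.tri i k hi (by omega)
        have := hb i
        omega
      · have := hg.tri (i + 1) (k + 2) (by omega) (by omega)
        have := hb i
        omega
    · rw [hne _ _ hm, hg.tri i m hi him]
  · by_cases hm : m = k + 1
    · subst hm
      rw [hne _ _ (by omega)]
      exact (hb i).2.1
    · by_cases hm' : m = k
      · subst hm'
        rw [hne _ m (by omega)]
        exact (hb i).2.2.1
      · rw [hne _ _ hm, hne _ _ (by omega)]
        exact hg.anti i m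
  · by_cases hm : m = k + 1
    · subst hm
      rw [hne _ (k + 1 + 1) (by omega)]
      exact (hb i).2.2.2
    · by_cases hm' : m = k
      · subst hm'
        rw [hne _ m (by omega)]
        exact (hb (i + 1)).1
      · rw [hne _ _ hm, hne _ _ (by omega)]
        exact hg.diag i m

lemma toggle_toggle (hg : IsPattern n sh g) (j k : ℕ) :
    toggle n j k (toggle n j k g) = g := by
  funext i m
  have hk : ∀ i, toggle n j k g i k = g i k := fun i => by simp [toggle]
  have hk2 : ∀ i, toggle n j k g i (k + 2) = g i (k + 2) := fun i => by simp [toggle]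
  by_cases hm : m = k + 1
  · subst hm
    rw [toggle, hk, hk, hk2, hk2]
    have h1 := hg.pred_le i k
    have h2 := hg.anti i k
    have h3 : g i (k + 2) ≤ g i (k + 1) := hg.anti i (k + 1)
    have h4 : g i (k + 1) ≤ g (i + 1) (k + 2) := hg.diag i (k + 1)
    by_cases hj : i ≤ n ∧ g i (k + 1) ≤ j
    · have ht : toggle n j k g i (k + 1) = min (min (g i k) (g (i + 1) (k + 2))) j +
          max (g (i - 1) k) (g i (k + 2)) - g i (k + 1) := by
        rw [toggle, if_pos ⟨rfl, hj⟩]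
      rw [if_pos ⟨rfl, hj.1, by omega⟩]
      omega
    · have ht : toggle n j k g i (k + 1) = g i (k + 1) := by
        rw [toggle, if_neg (by simpa using hj)]
      rw [ht, if_neg (by simpa using hj)]
  · simp [toggle, hm]

lemma max_toggle (hg : IsPattern n sh g) {j j' : ℕ} (hj : j ≤ j') (k i m : ℕ) :
    max (toggle n j k g i m) j' = max (g i m) j' := by
  by_cases hm : m = k + 1
  · subst hm
    have h1 := hg.pred_le i k
    have h3 : g i (k + 2) ≤ g i (k + 1) := hg.anti i (k + 1)
    simp only [toggle]
    split_ifs <;> omega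
  · simp [toggle, hm]

lemma wt_toggle_of_le (hg : IsPattern n sh g) {j j' : ℕ} (hj : j ≤ j') (k m : ℕ) :
    wt n (toggle n j k g) j' m = wt n g j' m := by
  simp only [wt, hg.max_toggle hj]

end IsPattern

lemma sum_min_add_max (a b : ℕ → ℕ) (h : a 0 ≤ b 0) (m : ℕ) :
    ∑ i ∈ Finset.range (m + 1), (min (a i) (b (i + 1)) + max (a (i - 1)) (b i)) + a m =
      ∑ i ∈ Finset.range (m + 1), a i + ∑ i ∈ Finset.range (m + 1), b i +
        min (a m) (b (m + 1)) := by
  induction m with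
  | zero => simp; omega
  | succ m ih =>
    rw [Finset.sum_range_succ, Finset.sum_range_succ a, Finset.sum_range_succ b]
    simp only [Nat.add_sub_cancel]
    omega

namespace IsPattern

lemma sum_min_toggle (hg : IsPattern n sh g) {j k : ℕ}
    (h : ∀ i ≤ n, j < g i (k + 1) → j < g i (k + 2)) :
    ∑ i ∈ Finset.range (n + 1), min (toggle n j k g i (k + 1)) j +
        ∑ i ∈ Finset.range (n + 1), min (g i (k + 1)) j =
      ∑ i ∈ Finset.range (n + 1), min (g i k) j +
        ∑ i ∈ Finset.range (n + 1), min (g i (k + 2)) j := by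
  have key := sum_min_add_max (fun i => min (g i k) j) (fun i => min (g i (k + 2)) j)
    (by simp [hg.tri 0 k (by omega) (by omega)]) n
  have hn : min (g n k) j ≤ min (g (n + 1) (k + 2)) j := by
    rw [hg.outer (n + 1) _ (by omega)]
    have := hg.le_shape n k
    have := hg.shape_monotone (Nat.le_succ n)
    simp only [Nat.succ_eq_add_one] at this
    omega
  rw [min_eq_left hn] at key
  rw [← Nat.add_right_cancel key, ← Finset.sum_add_distrib]
  refine Finset.sum_congr rfl fun i hi => ?_
  have hi : i ≤ n := Nat.lt_succ_iff.mp (Finset.mem_range.mp hi)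
  have h0 := h i hi
  have h1 := hg.pred_le i k
  have h2 := hg.anti i k
  have h3 : g i (k + 2) ≤ g i (k + 1) := hg.anti i (k + 1)
  have h4 : g i (k + 1) ≤ g (i + 1) (k + 2) := hg.diag i (k + 1)
  rcases le_or_gt (g i (k + 1)) j with hj | hj
  · rw [toggle, if_pos ⟨rfl, hi, hj⟩]
    omega
  · rw [toggle, if_neg (by omega)]
    have := h0 hj
    omega

lemma sum_max_zero (g : ℕ → ℕ → ℕ) (j k : ℕ) :
    ∑ i ∈ Finset.range (n + 1), max (g i k) 0 + (n + 1) * j =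
      ∑ i ∈ Finset.range (n + 1), max (g i k) j + ∑ i ∈ Finset.range (n + 1), min (g i k) j := by
  rw [← Finset.sum_add_distrib]
  simp only [max_add_min, Finset.sum_add_distrib]
  simp

lemma wt_toggle (hg : IsPattern n sh g) {j k : ℕ} (hk : k + 1 < n)
    (h : ∀ i ≤ n, j < g i (k + 1) → j < g i (k + 2)) :
    wt n (toggle n j k g) 0 k + wt n g j (k + 1) = wt n g 0 (k + 1) + wt n g j k ∧
      wt n (toggle n j k g) 0 (k + 1) + wt n g j k = wt n g 0 k + wt n g j (k + 1) := by
  have hg' := hg.toggle_isPattern j hk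
  have ek : ∀ i, toggle n j k g i k = g i k := fun i => by simp [toggle]
  have ek2 : ∀ i, toggle n j k g i (k + 1 + 1) = g i (k + 2) := fun i => by simp [toggle]
  have e0 := hg.sum_min_toggle h
  have e1 := hg'.wt_add 0 k
  have e2 := hg'.wt_add 0 (k + 1)
  have e3 := hg.wt_add 0 k
  have e4 := hg.wt_add 0 (k + 1)
  have e5 := hg.wt_add j k
  have e6 := hg.wt_add j (k + 1)
  have f1 := sum_max_zero (n := n) g j k
  have f2 := sum_max_zero (n := n) g j (k + 1)
  have f3 := sum_max_zero (n := n) g j (k + 2)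
  have f4 := sum_max_zero (n := n) (toggle n j k g) j (k + 1)
  simp only [hg.max_toggle le_rfl] at f4
  simp only [ek, ek2, add_assoc, Nat.reduceAdd] at *
  omega

lemma wt_toggle_of_ne (j k : ℕ) {m : ℕ} (hm : m ≠ k) (hm' : m ≠ k + 1) :
    wt n (toggle n j k g) 0 m = wt n g 0 m := by
  simp [wt, toggle, hm, hm']

end IsPattern

/-- The cut `j` is the last one at which `g` fails to be dominant, and `k` is the first failing
letter at this cut. -/
structure FirstBad (n : ℕ) (mu : ℕ → ℕ) (g : ℕ → ℕ → ℕ) (j k : ℕ) : Prop where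
  lt : k + 1 < n
  bad : mu (k + 1) + wt n g j (k + 1) < mu k + wt n g j k
  good_cut : ∀ j' k', j < j' → k' + 1 < n →
    mu k' + wt n g j' k' ≤ mu (k' + 1) + wt n g j' (k' + 1)
  good_letter : ∀ k' < k, mu k' + wt n g j k' ≤ mu (k' + 1) + wt n g j (k' + 1)

namespace FirstBad

lemma unique {j k j' k' : ℕ} (h : FirstBad n mu g j k) (h' : FirstBad n mu g j' k') :
    j = j' ∧ k = k' := by
  have hj : j = j' := by
    rcases lt_trichotomy j j' with hlt | heq | hlt
    · exact absurd (h.good_cut j' k' hlt h'.lt) (not_le.mpr h'.bad)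
    · exact heq
    · exact absurd (h'.good_cut j k hlt h.lt) (not_le.mpr h.bad)
  subst hj
  refine ⟨rfl, ?_⟩
  rcases lt_trichotomy k k' with hlt | heq | hlt
  · exact absurd (h'.good_letter k hlt) (not_le.mpr h.bad)
  · exact heq
  · exact absurd (h.good_letter k' hlt) (not_le.mpr h'.bad)

lemma exists_of_not_isGood (hmu : Monotone mu) (hg : IsPattern n sh g) (h : ¬ IsGood n mu g) :
    ∃ j k, FirstBad n mu g j k := by
  classical
  let P : ℕ → Prop := fun j =>
    ∃ k, k + 1 < n ∧ mu (k + 1) + wt n g j (k + 1) < mu k + wt n g j k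
  have hP : ∀ j, P j → j ≤ sh n := by
    rintro j ⟨k, _, hk⟩
    by_contra! hj
    rw [hg.wt_eq_zero hj.le, hg.wt_eq_zero hj.le] at hk
    have := hmu (Nat.le_succ k)
    simp only [Nat.succ_eq_add_one] at this
    omega
  obtain ⟨j₀, h₀⟩ : ∃ j, P j := by
    simp only [IsGood] at h
    push Not at h
    obtain ⟨j, k, h1, h2⟩ := h
    exact ⟨j, k, h1, h2⟩
  have hj : P (Nat.findGreatest P (sh n)) := Nat.findGreatest_spec (hP j₀ h₀) h₀
  refine ⟨Nat.findGreatest P (sh n), Nat.find hj, (Nat.find_spec hj).1, (Nat.find_spec hj).2,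
    fun j' k' hlt hk' => ?_, fun k' hk' => ?_⟩
  · by_contra! hbad
    have hP' : P j' := ⟨k', hk', hbad⟩
    exact absurd (Nat.le_findGreatest (hP j' hP') hP') (not_le.mpr hlt)
  · have := (Nat.find_spec hj).1
    by_contra! hbad
    exact absurd ⟨by omega, hbad⟩ (Nat.find_min hj hk')

lemma toggle {j k : ℕ} (h : FirstBad n mu g j k) (hg : IsPattern n sh g) :
    FirstBad n mu (toggle n j k g) j k := by
  refine ⟨h.lt, ?_, fun j' k' hj hk => ?_, fun k' hk => ?_⟩
  · simpa only [hg.wt_toggle_of_le le_rfl] using h.bad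
  · simpa only [hg.wt_toggle_of_le hj.le] using h.good_cut j' k' hj hk
  · simpa only [hg.wt_toggle_of_le le_rfl] using h.good_letter k' hk

lemma column {j k : ℕ} (h : FirstBad n mu g j k) (hg : IsPattern n sh g) :
    mu k + wt n g j k = mu (k + 1) + wt n g j (k + 1) + 1 ∧
      ∀ i ≤ n, j < g i (k + 1) → j < g i (k + 2) := by
  let c : ℕ → ℕ := fun m => ∑ i ∈ Finset.range (n + 1), if j < g i m then 1 else 0
  have hc : ∀ m, ∑ i ∈ Finset.range (n + 1), max (g i m) (j + 1) + c m =
      ∑ i ∈ Finset.range (n + 1), max (g i m) j + (n + 1) := fun m => by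
    rw [← Finset.sum_add_distrib]
    calc _ = ∑ i ∈ Finset.range (n + 1), (max (g i m) j + 1) :=
          Finset.sum_congr rfl fun i _ => by split_ifs <;> omega
      _ = _ := by rw [Finset.sum_add_distrib]; simp
  have hle : ∀ m, ∀ i ∈ Finset.range (n + 1),
      (if j < g i (m + 1) then 1 else 0) ≤ if j < g i m then 1 else 0 := fun m i _ => by
    have := hg.anti i m
    split_ifs <;> omega
  have hanti : ∀ m, c (m + 1) ≤ c m := fun m => Finset.sum_le_sum (hle m)
  have hsucc : ∀ m, c m ≤ c (m + 1) + 1 := fun m => by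
    calc c m ≤ ∑ i ∈ Finset.range (n + 1), if j < g (i + 1) (m + 1) then 1 else 0 :=
          Finset.sum_le_sum fun i _ => by
            have := hg.diag i m
            split_ifs <;> omega
      _ ≤ ∑ i ∈ Finset.range (n + 1 + 1), if j < g i (m + 1) then 1 else 0 := by
          rw [Finset.sum_range_succ' _ (n + 1)]
          exact Nat.le_add_right _ _
      _ ≤ c (m + 1) + 1 := by
          rw [Finset.sum_range_succ]
          exact Nat.add_le_add_left (by split_ifs <;> omega) _
  have e1 := hg.wt_add j k
  have e2 := hg.wt_add j (k + 1)
  have e3 := hg.wt_add (j + 1) k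
  have e4 := hg.wt_add (j + 1) (k + 1)
  have f1 := hc k
  have f2 := hc (k + 1)
  have f3 := hc (k + 1 + 1)
  have b := h.bad
  have b' := h.good_cut (j + 1) k (Nat.lt_succ_self j) h.lt
  have a1 := hsucc k
  have a2 := hanti (k + 1)
  refine ⟨by omega, fun i hi hj => ?_⟩
  have heq : c (k + 1 + 1) = c (k + 1) := by omega
  have := (Finset.sum_eq_sum_iff_of_le (hle (k + 1))).mp heq i (Finset.mem_range.mpr (by omega))
  by_contra hcon
  rw [if_pos hj, if_neg hcon] at this
  omega

end FirstBad

lemma finite_setOf_isPattern (n : ℕ) (sh : ℕ → ℕ) : {g | IsPattern n sh g}.Finite := by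
  refine Set.Finite.of_finite_image
    (f := fun g (a : Fin (n + 1)) (b : Fin (n + 1)) => g a b) ?_ ?_
  · refine Set.Finite.subset (Set.Finite.pi fun _ : Fin (n + 1) =>
      Set.Finite.pi fun _ : Fin (n + 1) => Set.finite_Iic (sh n)) ?_
    rintro _ ⟨g, hg, rfl⟩ a - b -
    exact (hg.le_shape _ _).trans (hg.shape_monotone (by omega))
  · intro g hg g' hg' h
    funext i k
    by_cases hi : i ≤ n
    · by_cases hk : i ≤ k
      · rw [hg.tri i k hi hk, hg'.tri i k hi hk]
      · exact congrFun (congrFun h ⟨i, by omega⟩) ⟨k, by omega⟩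
    · rw [hg.outer i k (by omega), hg'.outer i k (by omega)]

/-- The finite set of Gelfand–Tsetlin patterns of shape `sh`. -/
noncomputable def patterns (n : ℕ) (sh : ℕ → ℕ) : Finset (ℕ → ℕ → ℕ) :=
  (finite_setOf_isPattern n sh).toFinset

lemma mem_patterns : g ∈ patterns n sh ↔ IsPattern n sh g := by
  simp [patterns]

/-- The Schur polynomial of shape `sh`, as the generating function of the patterns. -/
noncomputable def schur (n : ℕ) (sh : ℕ → ℕ) : MvPolynomial (Fin n) ℤ :=
  ∑ g ∈ patterns n sh, ∏ i : Fin n, X i ^ wt n g 0 i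

lemma wt_toggle_top (hg : IsPattern n sh g) {k : ℕ} (hk : k + 1 < n) (i : Fin n) :
    wt n (toggle n (sh n) k g) 0 i =
      wt n g 0 (Equiv.swap (⟨k, by omega⟩ : Fin n) ⟨k + 1, hk⟩ i : Fin n) := by
  have h : ∀ i ≤ n, sh n < g i (k + 1) → sh n < g i (k + 2) := fun i hi hlt =>
    absurd ((hg.le_shape i (k + 1)).trans (hg.shape_monotone hi)) (not_le.mpr hlt)
  have hw := hg.wt_toggle hk h
  simp only [hg.wt_eq_zero le_rfl, add_zero] at hw
  rw [Equiv.swap_apply_def]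
  split_ifs with h1 h2
  · rw [h1]; exact hw.1
  · rw [h2]; exact hw.2
  · exact IsPattern.wt_toggle_of_ne _ _ (fun h => h1 (Fin.ext h)) (fun h => h2 (Fin.ext h))

lemma rename_swap_schur (n : ℕ) (sh : ℕ → ℕ) {k : ℕ} (hk : k + 1 < n) :
    rename (Equiv.swap (⟨k, by omega⟩ : Fin n) ⟨k + 1, hk⟩) (schur n sh) = schur n sh := by
  set τ := Equiv.swap (⟨k, by omega⟩ : Fin n) ⟨k + 1, hk⟩ with hτ
  rw [schur, map_sum]
  refine Finset.sum_bij' (fun g _ => toggle n (sh n) k g) (fun g _ => toggle n (sh n) k g)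
    ?_ ?_ ?_ ?_ ?_
  · exact fun g hg => mem_patterns.mpr ((mem_patterns.mp hg).toggle_isPattern _ hk)
  · exact fun g hg => mem_patterns.mpr ((mem_patterns.mp hg).toggle_isPattern _ hk)
  · exact fun g hg => (mem_patterns.mp hg).toggle_toggle _ _
  · exact fun g hg => (mem_patterns.mp hg).toggle_toggle _ _
  · intro g hg
    simp only [wt_toggle_top (mem_patterns.mp hg) hk, map_prod, map_pow, rename_X, ← hτ]
    refine Fintype.prod_equiv τ _ _ fun i => ?_
    simp [hτ]

lemma rename_schur (n : ℕ) (sh : ℕ → ℕ) (σ : Equiv.Perm (Fin n)) :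
    rename σ (schur n sh) = schur n sh := by
  cases n with
  | zero => rw [Subsingleton.elim σ 1]; exact rename_id_apply _
  | succ n =>
    have hσ : σ ∈ Submonoid.closure
        (Set.range fun i : Fin n => Equiv.swap i.castSucc i.succ) := by
      rw [Equiv.Perm.mclosure_swap_castSucc_succ]
      trivial
    induction hσ using Submonoid.closure_induction with
    | mem σ hσ =>
      obtain ⟨i, rfl⟩ := hσ
      exact rename_swap_schur (n + 1) sh (k := i) (by omega)
    | one => exact rename_id_apply _
    | mul σ τ _ _ h1 h2 => rw [Equiv.Perm.coe_mul, ← rename_rename, h2, h1]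

lemma alternant_eq_sum_rename (n : ℕ) (α : Fin n → ℕ) :
    alternant n α = ∑ σ : Equiv.Perm (Fin n),
      ((Equiv.Perm.sign σ : ℤˣ) : ℤ) • rename σ (∏ i : Fin n, (X i : MvPolynomial _ ℤ) ^ α i) := by
  simp [alternant, map_prod]

lemma alternant_comp_perm (n : ℕ) (α : Fin n → ℕ) (τ : Equiv.Perm (Fin n)) :
    alternant n (α ∘ τ) = ((Equiv.Perm.sign τ : ℤˣ) : ℤ) • alternant n α := by
  rw [alternant, alternant, Finset.smul_sum]
  refine Fintype.sum_equiv (Equiv.mulRight τ⁻¹) _ _ fun σ => ?_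
  have hs : Equiv.Perm.sign τ * Equiv.Perm.sign (σ * τ⁻¹) = Equiv.Perm.sign σ := by
    rw [Equiv.Perm.sign_mul, Equiv.Perm.sign_inv, mul_left_comm, Int.units_mul_self, mul_one]
  simp only [smul_smul, Equiv.coe_mulRight, ← Units.val_mul, hs]
  congr 1
  exact Fintype.prod_equiv τ _ _ fun i => by simp

lemma alternant_mul_schur_eq_sum (n : ℕ) (sh : ℕ → ℕ) (α : Fin n → ℕ) :
    alternant n α * schur n sh = ∑ g ∈ patterns n sh, alternant n fun i => α i + wt n g 0 i := by
  simp only [alternant_eq_sum_rename]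
  rw [Finset.sum_comm, Finset.sum_mul]
  refine Finset.sum_congr rfl fun σ _ => ?_
  rw [smul_mul_assoc, ← Finset.smul_sum]
  congr 1
  conv_lhs => rw [← rename_schur n sh σ]
  rw [← map_mul, ← map_sum, schur, Finset.mul_sum]
  simp only [pow_add, Finset.prod_mul_distrib]

open scoped Classical in
/-- The Littlewood–Richardson rule for the product of an alternant and a Schur polynomial. -/
theorem alternant_mul_schur (hmu : Monotone mu) (n : ℕ) (sh : ℕ → ℕ) :
    alternant n (fun i => mu i + i) * schur n sh =
      ∑ g ∈ patterns n sh with IsGood n mu g, alternant n fun i => mu i + wt n g 0 i + i := by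
  rw [alternant_mul_schur_eq_sum, ← Finset.sum_filter_add_sum_filter_not _ (IsGood n mu)]
  have hcomm : ∀ g : ℕ → ℕ → ℕ, (fun i : Fin n => mu i + i + wt n g 0 i) =
      fun i : Fin n => mu i + wt n g 0 i + i := fun g => funext fun i => add_right_comm _ _ _
  simp only [hcomm]
  refine add_eq_left.mpr ?_
  have hex : ∀ g ∈ {g ∈ patterns n sh | ¬ IsGood n mu g},
      ∃ p : ℕ × ℕ, FirstBad n mu g p.1 p.2 := fun g hg => by
    rw [Finset.mem_filter, mem_patterns] at hg
    obtain ⟨j, k, h⟩ := FirstBad.exists_of_not_isGood hmu hg.1 hg.2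
    exact ⟨(j, k), h⟩
  choose! p hp using hex
  have hpat : ∀ g ∈ {g ∈ patterns n sh | ¬ IsGood n mu g}, IsPattern n sh g := fun g hg =>
    mem_patterns.mp (Finset.mem_filter.mp hg).1
  have hmem : ∀ g ∈ {g ∈ patterns n sh | ¬ IsGood n mu g},
      toggle n (p g).1 (p g).2 g ∈ {g ∈ patterns n sh | ¬ IsGood n mu g} := fun g hg => by
    rw [Finset.mem_filter, mem_patterns]
    refine ⟨(hpat g hg).toggle_isPattern _ (hp g hg).lt, fun hgood => ?_⟩
    have h := (hp g hg).toggle (hpat g hg)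
    exact absurd (hgood _ _ h.lt) (not_le.mpr h.bad)
  have hcancel : ∀ g ∈ {g ∈ patterns n sh | ¬ IsGood n mu g},
      (alternant n fun i => mu i + wt n g 0 i + i) +
        (alternant n fun i => mu i + wt n (toggle n (p g).1 (p g).2 g) 0 i + i) = 0 := by
    intro g hg
    have hb := hp g hg
    obtain ⟨hw, hcol⟩ := hb.column (hpat g hg)
    have ht := (hpat g hg).wt_toggle hb.lt hcol
    set j := (p g).1
    set k := (p g).2
    have hk := hb.lt
    have hswap : (fun i : Fin n => mu i + wt n (toggle n j k g) 0 i + i) =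
        (fun i : Fin n => mu i + wt n g 0 i + i) ∘
          Equiv.swap (⟨k, by omega⟩ : Fin n) ⟨k + 1, hb.lt⟩ := by
      funext i
      rw [Function.comp_apply, Equiv.swap_apply_def]
      split_ifs with h1 h2
      · subst h1
        simp only
        omega
      · subst h2
        simp only
        omega
      · rw [IsPattern.wt_toggle_of_ne _ _ (fun h => h1 (Fin.ext h)) (fun h => h2 (Fin.ext h))]
    rw [hswap, alternant_comp_perm, Equiv.Perm.sign_swap (by simp)]
    simp
  refine Finset.sum_involution (fun g _ => toggle n (p g).1 (p g).2 g) hcancel ?_ hmem ?_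
  · intro g hg hne heq
    have := hcancel g hg
    rw [heq] at this
    exact hne (self_eq_neg.mp (eq_neg_of_add_eq_zero_left this))
  · intro g hg
    obtain ⟨h1, h2⟩ := (hp _ (hmem g hg)).unique ((hp g hg).toggle (hpat g hg))
    simp only [h1, h2]
    exact (hpat g hg).toggle_toggle _ _

/-- Extend a pattern with `m` rows to one with `n` rows by making every cell of the rows
`i > m` contain the largest possible letter `i - 1`. -/
def extend (n m : ℕ) (sh : ℕ → ℕ) (g : ℕ → ℕ → ℕ) : ℕ → ℕ → ℕ := fun i k =>
  if i ≤ m then g i k else if i ≤ n ∧ i ≤ k then 0 else sh i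

section extend

variable {m : ℕ}

lemma IsPattern.extend (hg : IsPattern m sh g) (hmn : m ≤ n) :
    IsPattern n sh (extend n m sh g) := by
  refine ⟨fun i k hi => ?_, fun i => ?_, fun i k hi hk => ?_, fun i k => ?_, fun i k => ?_⟩
  · rw [GelfandTsetlin.extend, if_neg (by omega), if_neg (by omega)]
  · rw [GelfandTsetlin.extend]
    split_ifs
    · exact hg.left i
    · omega
    · rfl
  · rw [GelfandTsetlin.extend]
    split_ifs with h h'
    · exact hg.tri i k h hk
    · rfl
    · omega
  · have := hg.anti i k
    simp only [GelfandTsetlin.extend]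
    split_ifs <;> omega
  · have h1 := hg.diag i k
    have h2 := hg.le_shape i k
    have h3 : sh i ≤ sh (i + 1) := hg.shape_monotone (Nat.le_succ i)
    have h4 := hg.tri i k
    simp only [GelfandTsetlin.extend]
    split_ifs <;> omega

lemma wt_extend_of_lt (hmn : m ≤ n) (j : ℕ) {k : ℕ} (hk : k < m) :
    wt n (extend n m sh g) j k = wt m g j k := by
  rw [wt, wt]
  have hsub : Finset.range (m + 1) ⊆ Finset.range (n + 1) :=
    Finset.range_subset_range.mpr (by omega)
  rw [← Finset.sum_subset hsub]
  · refine Finset.sum_congr rfl fun i hi => ?_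
    rw [Finset.mem_range] at hi
    simp only [extend, if_pos (Nat.lt_succ_iff.mp hi)]
  · intro i _ hi
    rw [Finset.mem_range] at hi
    simp only [extend]
    rw [if_neg (by omega), if_neg (by omega), if_neg (by omega), if_neg (by omega), Nat.sub_self]

lemma wt_extend_of_ge (hg : IsPattern m sh g) (j : ℕ) {k : ℕ} (hk : m ≤ k) (hkn : k < n) :
    wt n (extend n m sh g) j k = max (sh (k + 1)) j - j := by
  rw [wt, Finset.sum_eq_single_of_mem (k + 1) (Finset.mem_range.mpr (by omega))]
  · simp only [extend]
    rw [if_neg (by omega), if_neg (by omega), if_neg (by omega), if_pos (by omega), Nat.zero_max]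
  · intro i hi hne
    rw [Finset.mem_range] at hi
    simp only [extend]
    split_ifs <;> first | omega | skip
    rw [hg.tri i k (by omega) (by omega), hg.tri i (k + 1) (by omega) (by omega), Nat.sub_self]

lemma IsPattern.wt_last_le (hg : IsPattern (m + 1) sh g) (j : ℕ) :
    wt (m + 1) g j m ≤ max (sh (m + 1)) j - j := by
  rw [wt, Finset.sum_eq_single_of_mem (m + 1) (Finset.mem_range.mpr (by omega))]
  · have := hg.le_shape (m + 1) m
    omega
  · intro i hi hne
    rw [Finset.mem_range] at hi
    rw [hg.tri i m (by omega) (by omega), hg.tri i (m + 1) (by omega) (by omega), Nat.sub_self]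

lemma IsGood.extend (hmu : Monotone mu) (hg : IsPattern m sh g) (hgood : IsGood m mu g)
    (hmn : m ≤ n) : IsGood n mu (extend n m sh g) := by
  intro j k hk
  have h1 : mu k ≤ mu (k + 1) := hmu (Nat.le_succ k)
  have h2 : sh (k + 1) ≤ sh (k + 1 + 1) := hg.shape_monotone (Nat.le_succ _)
  rcases lt_trichotomy (k + 1) m with h | h | h
  · rw [wt_extend_of_lt hmn j h, wt_extend_of_lt hmn j (by omega)]
    exact hgood j k h
  · subst h
    rw [wt_extend_of_lt hmn j (by omega), wt_extend_of_ge hg j le_rfl hk]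
    have := hg.wt_last_le j
    omega
  · rw [wt_extend_of_ge hg j (by omega) (by omega), wt_extend_of_ge hg j (by omega) hk]
    omega

end extend

/-- Only the pattern with largest possible entries has all partial weights dominant. -/
lemma IsPattern.eq_shape_of_isGood (hg : IsPattern n sh g) (hgood : IsGood n (fun _ => 0) g) :
    ∀ i k, k < i → g i k = sh i := by
  have hmono : ∀ j m, m < n → ∀ k ≤ m, wt n g j k ≤ wt n g j m := by
    intro j m hm k hk
    induction m, hk using Nat.le_induction with
    | base => exact le_rfl
    | succ m _ ih =>
      have := hgood j m hm
      simp only [zero_add] at this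
      exact (ih (by omega)).trans this
  suffices h : ∀ d i, i ≤ n → n - i = d → ∀ k < i, g i k = sh i by
    intro i k hk
    by_cases hi : i ≤ n
    · exact h _ i hi rfl k hk
    · exact hg.outer i k (by omega)
  intro d
  induction d using Nat.strong_induction_on with
  | _ d ih =>
    intro i hi hd k hk
    obtain ⟨m, rfl⟩ : ∃ m, i = m + 1 := ⟨i - 1, by omega⟩
    have hw : wt n g (g (m + 1) m) m = 0 := by
      refine Finset.sum_eq_zero fun r hr => ?_
      rw [Finset.mem_range] at hr
      rcases lt_trichotomy r (m + 1) with h | h | h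
      · rw [hg.tri r m (by omega) (by omega)]
        omega
      · subst h
        omega
      · rw [ih (n - r) (by omega) r (by omega) rfl m (by omega),
          ih (n - r) (by omega) r (by omega) rfl (m + 1) h, Nat.sub_self]
    have hsum := hg.sum_wt_add (g (m + 1) m) (m + 1)
    rw [Finset.sum_eq_zero fun k hk => Nat.eq_zero_of_le_zero
      (hw ▸ hmono _ m (by omega) k (Nat.lt_succ_iff.mp (Finset.mem_range.mp hk))),
      zero_add] at hsum
    have hrow := (Finset.sum_eq_sum_iff_of_le fun r _ =>
      max_le_max_right _ (hg.le_shape r (m + 1))).mp hsum (m + 1) (Finset.mem_range.mpr (by omega))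
    rw [hg.tri (m + 1) (m + 1) hi le_rfl] at hrow
    have h1 : g (m + 1) m ≤ g (m + 1) k :=
      (antitone_nat_of_succ_le (hg.anti (m + 1))) (Nat.lt_succ_iff.mp hk)
    have h2 := hg.le_shape (m + 1) k
    omega

/-- The shape whose rows `1, 2, …` have lengths `f 0, f 1, …`. -/
def shape (f : ℕ → ℕ) : ℕ → ℕ
  | 0 => 0
  | i + 1 => f i

lemma shape_monotone {f : ℕ → ℕ} (hf : Monotone f) : Monotone (shape f) :=
  monotone_nat_of_le_succ fun i => by
    cases i with
    | zero => exact Nat.zero_le _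
    | succ i => exact hf (Nat.le_succ i)

/-- The bialternant formula. -/
lemma alternant_zero_mul_schur {f : ℕ → ℕ} (hf : Monotone f) (n : ℕ) :
    alternant n (fun i => (i : ℕ)) * schur n (shape f) = alternant n fun i => f i + i := by
  classical
  have h0 : IsPattern 0 (shape f) fun i _ => shape f i := by
    refine ⟨fun _ _ _ => rfl, fun _ => rfl, fun i k hi _ => ?_, fun _ _ => le_rfl,
      fun i _ => shape_monotone hf (Nat.le_succ i)⟩
    rw [Nat.le_zero.mp hi]
    rfl
  have hmu : Monotone fun _ : ℕ => 0 := monotone_const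
  have key := alternant_mul_schur hmu n (shape f)
  have hfilter : {g ∈ patterns n (shape f) | IsGood n (fun _ => 0) g} =
      {extend n 0 (shape f) fun i _ => shape f i} := by
    ext g
    rw [Finset.mem_filter, mem_patterns, Finset.mem_singleton]
    have hext := h0.extend (Nat.zero_le n)
    have hgood := IsGood.extend hmu h0 (fun _ _ h => by omega) (Nat.zero_le n)
    refine ⟨fun ⟨hg, hg'⟩ => ?_, fun h => h ▸ ⟨hext, hgood⟩⟩
    funext i k
    by_cases hk : k < i
    · rw [hg.eq_shape_of_isGood hg' i k hk, hext.eq_shape_of_isGood hgood i k hk]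
    · by_cases hi : i ≤ n
      · rw [hg.tri i k hi (by omega), hext.tri i k hi (by omega)]
      · rw [hg.outer i k (by omega), hext.outer i k (by omega)]
  rw [hfilter, Finset.sum_singleton] at key
  simp only [zero_add] at key
  rw [key]
  congr 1
  funext i
  rw [wt_extend_of_ge h0 0 (Nat.zero_le _) i.isLt]
  simp [shape]

open scoped Classical in
/-- The Littlewood–Richardson rule. -/
theorem alternant_mul_alternant {f : ℕ → ℕ} (hf : Monotone f) (hmu : Monotone mu) (n : ℕ) :
    alternant n (fun i => f i + i) * alternant n (fun i => mu i + i) =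
      ∑ g ∈ patterns n (shape f) with IsGood n mu g,
        alternant n (fun i => mu i + wt n g 0 i + i) * alternant n fun i => (i : ℕ) := by
  rw [← alternant_zero_mul_schur hf, ← Finset.sum_mul, ← alternant_mul_schur hmu]
  ring

lemma IsGood.monotone (h : IsGood n mu g) : Monotone fun i : Fin n => mu i + wt n g 0 i := by
  cases n with
  | zero => exact fun i => i.elim0
  | succ n => exact Fin.monotone_iff_le_succ.mpr fun i => h 0 i (by simp)

lemma coeff_alternant {α β : Fin n → ℕ} (hα : StrictMono α) (hβ : StrictMono β) :
    coeff (Finsupp.equivFunOnFinite.symm β) (alternant n α) = if α = β then 1 else 0 := by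
  have hterm : ∀ σ : Equiv.Perm (Fin n), ∏ i, (X (σ i) : MvPolynomial (Fin n) ℤ) ^ α i =
      monomial (Finsupp.equivFunOnFinite.symm (α ∘ σ.symm)) 1 := fun σ => by
    rw [monomial_eq, map_one, one_mul, Finsupp.prod_fintype _ _ fun _ => pow_zero _]
    exact Fintype.prod_equiv σ _ _ fun i => by simp
  simp only [alternant, hterm, coeff_sum, coeff_smul, coeff_monomial,
    Finsupp.equivFunOnFinite.symm.injective.eq_iff]
  rw [Finset.sum_eq_single 1]
  · simp [show (Equiv.symm (1 : Equiv.Perm (Fin n))) = 1 from rfl]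
  · intro σ _ hσ
    rw [if_neg, smul_zero]
    rintro rfl
    have hmono : StrictMono σ.symm := fun i j hij => hα.lt_iff_lt.mp (hβ hij)
    refine hσ (Equiv.ext fun i => ?_)
    have := congrFun (Subsingleton.elim (α := Fin n ≃o Fin n)
      (hmono.orderIsoOfSurjective _ σ.symm.surjective) (OrderIso.refl _) |> congrArg (⇑)) (σ i)
    simpa using this.symm
  · simp

lemma strictMono_add_val {α : Fin n → ℕ} (h : Monotone α) : StrictMono fun i => α i + (i : ℕ) :=
  fun _ _ hij => add_lt_add_of_le_of_lt (h hij.le) hij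

lemma alternant_val_ne_zero (n : ℕ) : alternant n (fun i => (i : ℕ)) ≠ 0 := fun h => by
  have := coeff_alternant (n := n) (α := fun i => (i : ℕ)) (fun _ _ h => h) (fun _ _ h => h)
  simp [h] at this

open scoped Classical in
/-- The Littlewood–Richardson coefficients counted by good patterns. -/
noncomputable def lrCoeff (n : ℕ) (mu sh : ℕ → ℕ) : (Fin n → ℕ) →₀ ℕ :=
  ∑ g ∈ patterns n sh with IsGood n mu g, Finsupp.single (fun i : Fin n => mu i + wt n g 0 i) 1

lemma mem_support_lrCoeff {ν : Fin n → ℕ} : ν ∈ (lrCoeff n mu sh).support ↔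
    ∃ g, IsPattern n sh g ∧ IsGood n mu g ∧ (fun i : Fin n => mu i + wt n g 0 i) = ν := by
  classical
  rw [Finsupp.mem_support_iff, lrCoeff, Finsupp.finsetSum_apply, Ne, Finset.sum_eq_zero_iff]
  simp [Finsupp.single_apply, mem_patterns]

lemma isLRExpansion_lrCoeff {f : ℕ → ℕ} (hf : Monotone f) (hmu : Monotone mu) (n : ℕ) :
    IsLRExpansion n (fun i => f i) (fun i => mu i) (lrCoeff n mu (shape f)) := by
  classical
  refine ⟨fun ν hν => ?_, ?_⟩
  · obtain ⟨g, -, hg, rfl⟩ := mem_support_lrCoeff.mp hν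
    exact hg.monotone
  · rw [alternant_mul_alternant hf hmu, lrCoeff,
      ← Finsupp.sum_finsetSum_index (by simp) (by intros; push_cast; rw [add_smul])]
    simp

/-- The coefficients of a Littlewood–Richardson expansion are determined by the product. -/
lemma _root_.IsLRExpansion.unique {lam mu : Fin n → ℕ} {c c' : (Fin n → ℕ) →₀ ℕ}
    (h : IsLRExpansion n lam mu c) (h' : IsLRExpansion n lam mu c') : c = c' := by
  have key := h.2.symm.trans h'.2
  simp only [← smul_mul_assoc, Finsupp.sum, ← Finset.sum_mul] at key
  have key := mul_right_cancel₀ (alternant_val_ne_zero n) key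
  have hcoeff : ∀ c : (Fin n → ℕ) →₀ ℕ, (∀ ν ∈ c.support, Monotone ν) → ∀ ν : Fin n → ℕ,
      Monotone ν → coeff (Finsupp.equivFunOnFinite.symm fun i => ν i + (i : ℕ))
        (∑ ν ∈ c.support, (c ν : ℤ) • alternant n fun i => ν i + i) = c ν := by
    intro c hc ν hν
    rw [coeff_sum, Finset.sum_congr rfl fun ν' hν' => by
      rw [coeff_smul, coeff_alternant (strictMono_add_val (hc ν' hν')) (strictMono_add_val hν)]]
    have hinj : ∀ ν' : Fin n → ℕ, ((fun i => ν' i + (i : ℕ)) = fun i => ν i + (i : ℕ)) ↔ ν' = ν :=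
      fun ν' => by simp [funext_iff]
    simp +contextual [hinj]
  ext ν
  by_cases hν : Monotone ν
  · have := hcoeff c h.1 ν hν
    rw [key, hcoeff c' h'.1 ν hν] at this
    exact_mod_cast this.symm
  · rw [Finsupp.notMem_support_iff.mp (mt (h.1 ν) hν),
      Finsupp.notMem_support_iff.mp (mt (h'.1 ν) hν)]

lemma exists_monotone_extension {α : Fin n → ℕ} (hα : Monotone α) (hn : 0 < n) :
    ∃ f : ℕ → ℕ, Monotone f ∧ ∀ i : Fin n, α i = f i := by
  refine ⟨fun i => α ⟨min i (n - 1), by omega⟩, fun i j hij => hα ?_, fun i => ?_⟩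
  · simp only [Fin.mk_le_mk]
    omega
  · congr 1
    ext
    simp only
    omega

end GelfandTsetlin

open GelfandTsetlin

/-- Let `λ, μ` be partitions with `n` parts, `0 ≤ p ≤ n-1`, and let
`λ' = (λ_p,…,λ_0)`, `μ' = (μ_p,…,μ_0)` be their truncations to the lowest `p+1`
parts.  If `c^{ν'}_{λ'μ'} ≠ 0` for some partition `ν'` with `p+1` parts, then
`c^ν_{λμ} ≠ 0` for
`ν = (λ_{n-1}+μ_{n-1}, …, λ_{p+1}+μ_{p+1}, ν'_p, …, ν'_0)`. -/
theorem lr_coeff_of_truncation (n p : ℕ) (hp : p + 1 ≤ n)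
    (lam mu : Fin n → ℕ) (hlam : Monotone lam) (hmu : Monotone mu)
    (nu' : Fin (p + 1) → ℕ) (hnu' : Monotone nu')
    (htrunc : ∃ c' : (Fin (p + 1) → ℕ) →₀ ℕ,
      IsLRExpansion (p + 1)
        (fun i => lam ⟨i, lt_of_lt_of_le i.isLt hp⟩)
        (fun i => mu ⟨i, lt_of_lt_of_le i.isLt hp⟩) c' ∧
      nu' ∈ c'.support) :
    ∃ c : (Fin n → ℕ) →₀ ℕ, IsLRExpansion n lam mu c ∧
      (fun i : Fin n =>
        if h : (i : ℕ) < p + 1 then nu' ⟨i, h⟩ else lam i + mu i) ∈ c.support := by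
  obtain ⟨f, hf, hlamf⟩ := exists_monotone_extension hlam (by omega)
  obtain ⟨m, hm, hmum⟩ := exists_monotone_extension hmu (by omega)
  obtain ⟨c', hc', hnu⟩ := htrunc
  obtain rfl : lam = fun i : Fin n => f i := funext hlamf
  obtain rfl : mu = fun i : Fin n => m i := funext hmum
  rw [hc'.unique (isLRExpansion_lrCoeff hf hm (p + 1)), mem_support_lrCoeff] at hnu
  obtain ⟨g, hg, hgood, rfl⟩ := hnu
  refine ⟨lrCoeff n m (shape f), isLRExpansion_lrCoeff hf hm n, mem_support_lrCoeff.mpr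
    ⟨extend n (p + 1) (shape f) g, hg.extend hp, hgood.extend hm hg hp, funext fun i => ?_⟩⟩
  split_ifs with h
  · rw [wt_extend_of_lt hp 0 h]
  · rw [wt_extend_of_ge hg 0 (not_lt.mp h) i.isLt]
    simp [shape, add_comm]
end
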